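/- arXiv:math/0511713 — 8 statements merged into one kernel-verified Lean document; each statement's English description precedes it below -/
import Mathlib

section
/- (Tropical Cramer rule with pseudodeterminants.) Let A be an n×(n+1) real matrix, let Ã be an n×(n+1) matrix with entries in K* such that T(Ã_{ij}) = A_{ij} for all i,j, and let B be the matrix of principal coefficients, B_{ij} = Pc(Ã_{ij}) ∈ k*. If no entry of Cram_A(B) is zero, then the homogeneous linear system Ã·x = 0 has a one-dimensional solution space (a unique projective solution), every nonzero solution x̃ has all its n+1 coordinates in K*, and there is λ ∈ 𝕋 such that T(x̃_i) = |A^i|_t + λ for every i; that is, the tropicalization of the solution equals the stable tropical solution [|A^1|_t : … : |A^{n+1}|_t]. -/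
open Finset

/-- An algebraically closed field `K` with a nontrivial rank-one valuation `v : K* → ℝ`,
residue field `k` (with residue map `res`, defined on the valuation ring
`{x | x = 0 ∨ 0 ≤ v x}`), and a fixed multiplicative section `sec` of the valuation
(`sec γ` plays the role of `t^γ`). -/
structure TropValField (K k : Type*) [Field K] [Field k] where
  v : K → ℝ
  sec : ℝ → K
  res : K → k
  v_mul : ∀ x y : K, x ≠ 0 → y ≠ 0 → v (x * y) = v x + v y
  v_add : ∀ x y : K, x ≠ 0 → y ≠ 0 → x + y ≠ 0 → min (v x) (v y) ≤ v (x + y)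
  v_nontrivial : ∃ x : K, x ≠ 0 ∧ v x ≠ 0
  sec_ne : ∀ a : ℝ, sec a ≠ 0
  sec_add : ∀ a b : ℝ, sec (a + b) = sec a * sec b
  v_sec : ∀ a : ℝ, v (sec a) = a
  res_add : ∀ x y : K, (x = 0 ∨ 0 ≤ v x) → (y = 0 ∨ 0 ≤ v y) → res (x + y) = res x + res y
  res_mul : ∀ x y : K, (x = 0 ∨ 0 ≤ v x) → (y = 0 ∨ 0 ≤ v y) → res (x * y) = res x * res y
  res_one : res 1 = 1
  res_zero_iff : ∀ x : K, (x = 0 ∨ 0 ≤ v x) → (res x = 0 ↔ x = 0 ∨ 0 < v x)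
  res_surj : Function.Surjective res

/-- The tropicalization map `T x = -v x`. -/
def TropValField.T {K k : Type*} [Field K] [Field k] (V : TropValField K k) (x : K) : ℝ :=
  -(V.v x)

/-- The principal coefficient `Pc x = res (x · t^{-v x}) ∈ k*` of `x ∈ K*`. -/
def TropValField.Pc {K k : Type*} [Field K] [Field k] (V : TropValField K k) (x : K) : k :=
  V.res (x * V.sec (-(V.v x)))

/-- The tropical determinant `|A|_t = max_σ Σ_i A i (σ i)` of a square real matrix. -/
noncomputable def tropDet {n : ℕ} (A : Matrix (Fin n) (Fin n) ℝ) : ℝ :=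
  Finset.univ.sup' ⟨1, Finset.mem_univ 1⟩ fun σ : Equiv.Perm (Fin n) => ∑ i, A i (σ i)

open Classical in
/-- The pseudodeterminant `Δ_A(B)`: the signed sum over those permutations attaining the
tropical determinant of `A` of the corresponding products of entries of `B`. -/
noncomputable def pseudoDet {n : ℕ} {R : Type*} [CommRing R]
    (A : Matrix (Fin n) (Fin n) ℝ) (B : Matrix (Fin n) (Fin n) R) : R :=
  ∑ σ ∈ Finset.univ.filter
      (fun σ : Equiv.Perm (Fin n) => ∑ i, A i (σ i) = tropDet A),
    ((Equiv.Perm.sign σ : ℤ) : R) * ∏ i, B i (σ i)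

/-- Delete the `i`-th column of an `n × (n+1)` matrix. -/
def delCol {n : ℕ} {R : Type*} (A : Matrix (Fin n) (Fin (n + 1)) R) (i : Fin (n + 1)) :
    Matrix (Fin n) (Fin n) R :=
  fun r c => A r (i.succAbove c)

namespace TropValField

variable {K k : Type*} [Field K] [Field k] (V : TropValField K k)

theorem v_one : V.v 1 = 0 := by
  have h := V.v_mul 1 1 one_ne_zero one_ne_zero
  rw [mul_one] at h
  linarith

theorem v_neg_one : V.v (-1) = 0 := by
  have h := V.v_mul (-1) (-1) (neg_ne_zero.mpr one_ne_zero) (neg_ne_zero.mpr one_ne_zero)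
  rw [neg_mul_neg, mul_one, V.v_one] at h
  linarith

theorem v_neg_one_pow (m : ℕ) : V.v ((-1) ^ m) = 0 := by
  rcases neg_one_pow_eq_or K m with h | h <;> rw [h]
  exacts [V.v_one, V.v_neg_one]

theorem sec_zero : V.sec 0 = 1 := by
  have h := V.sec_add 0 0
  rw [add_zero] at h
  exact (mul_eq_left₀ (V.sec_ne 0)).mp h.symm

theorem sec_sum {ι : Type*} (s : Finset ι) (f : ι → ℝ) :
    V.sec (∑ i ∈ s, f i) = ∏ i ∈ s, V.sec (f i) := by
  classical
  induction s using Finset.induction_on with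
  | empty => simp [V.sec_zero]
  | insert a s ha ih => rw [Finset.sum_insert ha, Finset.prod_insert ha, V.sec_add, ih]

theorem integral_mul {x y : K} (hx : x = 0 ∨ 0 ≤ V.v x) (hy : y = 0 ∨ 0 ≤ V.v y) :
    x * y = 0 ∨ 0 ≤ V.v (x * y) := by
  by_cases hx0 : x = 0
  · simp [hx0]
  by_cases hy0 : y = 0
  · simp [hy0]
  rw [V.v_mul x y hx0 hy0]
  exact Or.inr (add_nonneg (hx.resolve_left hx0) (hy.resolve_left hy0))

/-- The valuation ring. -/
def integers : Subring K where
  carrier := {x | x = 0 ∨ 0 ≤ V.v x}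
  mul_mem' := V.integral_mul
  one_mem' := Or.inr V.v_one.ge
  zero_mem' := Or.inl rfl
  neg_mem' {x} hx := by
    rw [← neg_one_mul]
    exact V.integral_mul (Or.inr V.v_neg_one.ge) hx
  add_mem' {x y} hx hy := by
    by_cases hx0 : x = 0
    · simpa [hx0] using hy
    by_cases hy0 : y = 0
    · simpa [hy0] using hx
    by_cases hxy : x + y = 0
    · exact Or.inl hxy
    exact Or.inr ((le_min (hx.resolve_left hx0) (hy.resolve_left hy0)).trans
      (V.v_add x y hx0 hy0 hxy))

/-- The residue map as a ring homomorphism on the valuation ring. -/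
def residue : V.integers →+* k where
  toFun x := V.res x
  map_one' := V.res_one
  map_mul' x y := V.res_mul x y x.2 y.2
  map_zero' := (V.res_zero_iff 0 (Or.inl rfl)).mpr (Or.inl rfl)
  map_add' x y := V.res_add x y x.2 y.2

theorem sec_mem_integers {c : ℝ} (hc : 0 ≤ c) : V.sec c ∈ V.integers :=
  Or.inr (by rwa [V.v_sec])

theorem res_sec {c : ℝ} (hc : 0 ≤ c) : V.res (V.sec c) = if c = 0 then 1 else 0 := by
  split_ifs with h
  · rw [h, V.sec_zero, V.res_one]
  · refine (V.res_zero_iff _ (V.sec_mem_integers hc)).mpr (Or.inr ?_)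
    rw [V.v_sec]
    exact lt_of_le_of_ne hc (Ne.symm h)

theorem mul_sec_mem_integers {x : K} (hx : x ≠ 0) : x * V.sec (-V.v x) ∈ V.integers :=
  Or.inr (by rw [V.v_mul _ _ hx (V.sec_ne _), V.v_sec, add_neg_cancel])

theorem v_eq_zero_of_res_ne_zero {x : K} (hx : x ∈ V.integers) (h : V.res x ≠ 0) :
    x ≠ 0 ∧ V.v x = 0 := by
  rw [Ne, V.res_zero_iff x hx, not_or, not_lt] at h
  exact ⟨h.1, le_antisymm h.2 (hx.resolve_left h.1)⟩

/-- After rescaling by `t ^ |A|_t`, the determinant of a lift of `A` is integral and reduces to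
the pseudodeterminant of the principal coefficients. -/
theorem det_mul_sec_tropDet {n : ℕ} (A : Matrix (Fin n) (Fin n) ℝ) (M : Matrix (Fin n) (Fin n) K)
    (hne : ∀ i j, M i j ≠ 0) (hA : ∀ i j, V.T (M i j) = A i j) :
    M.det * V.sec (tropDet A) ∈ V.integers ∧
      V.res (M.det * V.sec (tropDet A)) = pseudoDet A fun i j => V.Pc (M i j) := by
  classical
  have hle (σ : Equiv.Perm (Fin n)) : 0 ≤ tropDet A - ∑ i, A i (σ i) :=
    sub_nonneg.mpr (Finset.le_sup' (fun σ : Equiv.Perm (Fin n) => ∑ i, A i (σ i))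
      (Finset.mem_univ σ))
  let U (i j : Fin n) : V.integers := ⟨_, V.mul_sec_mem_integers (hne i j)⟩
  let z : V.integers := ∑ σ : Equiv.Perm (Fin n),
    ((Equiv.Perm.sign σ : ℤ) : V.integers) * (∏ i, U i (σ i)) * ⟨_, V.sec_mem_integers (hle σ)⟩
  have hz : (z : K) = M.det * V.sec (tropDet A) := by
    rw [← Matrix.det_transpose, Matrix.det_apply', Finset.sum_mul]
    simp only [z, AddSubmonoidClass.coe_finsetSum, MulMemClass.coe_mul,
      SubmonoidClass.coe_finsetProd, SubringClass.coe_intCast, Matrix.transpose_apply]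
    refine Finset.sum_congr rfl fun σ _ => ?_
    have hU (i : Fin n) : (U i (σ i) : K) = M i (σ i) * V.sec (A i (σ i)) := by
      rw [← hA]; rfl
    simp only [hU, Finset.prod_mul_distrib, ← V.sec_sum]
    rw [mul_assoc, mul_assoc, ← V.sec_add, add_sub_cancel, mul_assoc]
  refine hz ▸ ⟨z.2, ?_⟩
  change V.residue z = _
  simp only [z, map_sum, map_mul, map_prod, map_intCast, pseudoDet]
  rw [Finset.sum_filter]
  refine Finset.sum_congr rfl fun σ _ => ?_
  have hsec : V.residue ⟨_, V.sec_mem_integers (hle σ)⟩ =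
      if tropDet A - ∑ i, A i (σ i) = 0 then 1 else 0 := V.res_sec (hle σ)
  rw [hsec, mul_ite, mul_one, mul_zero]
  refine if_congr ?_ rfl rfl
  rw [sub_eq_zero, eq_comm]

theorem det_ne_zero_and_T_det {n : ℕ} (A : Matrix (Fin n) (Fin n) ℝ)
    (M : Matrix (Fin n) (Fin n) K) (hne : ∀ i j, M i j ≠ 0) (hA : ∀ i j, V.T (M i j) = A i j)
    (h : pseudoDet A (fun i j => V.Pc (M i j)) ≠ 0) :
    M.det ≠ 0 ∧ V.T M.det = tropDet A := by
  obtain ⟨hmem, hres⟩ := V.det_mul_sec_tropDet A M hne hA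
  obtain ⟨h0, hv⟩ := V.v_eq_zero_of_res_ne_zero hmem (hres ▸ h)
  have hdet : M.det ≠ 0 := left_ne_zero_of_mul h0
  rw [V.v_mul _ _ hdet (V.sec_ne _), V.v_sec] at hv
  exact ⟨hdet, by rw [T]; linarith⟩

end TropValField

/-- The vector of signed maximal minors of an `n × (n + 1)` matrix. -/
def signedMinors {n : ℕ} {R : Type*} [CommRing R] (M : Matrix (Fin n) (Fin (n + 1)) R) :
    Fin (n + 1) → R :=
  fun j => (-1) ^ (j : ℕ) * (delCol M j).det

theorem mulVec_signedMinors {n : ℕ} {R : Type*} [CommRing R]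
    (M : Matrix (Fin n) (Fin (n + 1)) R) : M.mulVec (signedMinors M) = 0 := by
  funext r
  let N : Matrix (Fin (n + 1)) (Fin (n + 1)) R := Matrix.of (Fin.cons (M r) M)
  have hN : N.det = 0 :=
    Matrix.det_zero_of_row_eq (Fin.succ_ne_zero r).symm rfl
  rw [Matrix.det_succ_row_zero] at hN
  rw [Pi.zero_apply, ← hN, Matrix.mulVec, dotProduct]
  refine Finset.sum_congr rfl fun j _ => ?_
  have hsub : N.submatrix Fin.succ j.succAbove = delCol M j := rfl
  have hrow : N 0 j = M r j := rfl
  rw [hsub, hrow, signedMinors]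
  ring

theorem eq_zero_of_mulVec_eq_zero_of_apply_zero {n : ℕ} {K : Type*} [Field K]
    (M : Matrix (Fin n) (Fin (n + 1)) K) (hdet : (delCol M 0).det ≠ 0) {x : Fin (n + 1) → K}
    (hx : M.mulVec x = 0) (hx0 : x 0 = 0) : x = 0 := by
  have htail : (delCol M 0).mulVec (fun c => x c.succ) = 0 := by
    funext r
    have hr := congrFun hx r
    simpa [Matrix.mulVec, dotProduct, Fin.sum_univ_succ, hx0, delCol] using hr
  have h := Matrix.eq_zero_of_mulVec_eq_zero hdet htail
  funext i
  exact Fin.cases hx0 (fun c => congrFun h c) i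

theorem exists_eq_smul_signedMinors {n : ℕ} {K : Type*} [Field K]
    (M : Matrix (Fin n) (Fin (n + 1)) K) (hdet : (delCol M 0).det ≠ 0) {x : Fin (n + 1) → K}
    (hx : M.mulVec x = 0) : ∃ c : K, c • signedMinors M = x := by
  have h0 : signedMinors M 0 ≠ 0 := by simpa [signedMinors] using hdet
  refine ⟨x 0 / signedMinors M 0, (sub_eq_zero.mp ?_).symm⟩
  refine eq_zero_of_mulVec_eq_zero_of_apply_zero M hdet ?_ ?_
  · rw [Matrix.mulVec_sub, Matrix.mulVec_smul, mulVec_signedMinors, hx, smul_zero, sub_zero]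
  · simp [h0]

/-- tropical Cramer rule with pseudodeterminants.  If no entry of
`Cram_A(Pc Ã)` vanishes, then `Ã x = 0` has a unique projective solution, its coordinates
lie in `K*`, and it tropicalizes to the stable tropical solution
`[|A^1|_t : … : |A^{n+1}|_t]`. -/
theorem tropical_cramer_pseudodeterminants
    {K k : Type*} [Field K] [IsAlgClosed K] [Field k] (V : TropValField K k)
    {n : ℕ} (A : Matrix (Fin n) (Fin (n + 1)) ℝ) (At : Matrix (Fin n) (Fin (n + 1)) K)
    (hne : ∀ r c, At r c ≠ 0) (htrop : ∀ r c, V.T (At r c) = A r c)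
    (hcram : ∀ i : Fin (n + 1),
      pseudoDet (delCol A i) (delCol (fun r c => V.Pc (At r c)) i) ≠ 0) :
    Module.finrank K ↥(LinearMap.ker At.mulVecLin) = 1 ∧
    ∀ x : Fin (n + 1) → K, At.mulVec x = 0 → x ≠ 0 →
      (∀ i, x i ≠ 0) ∧ ∃ lam : ℝ, ∀ i, V.T (x i) = tropDet (delCol A i) + lam := by
  have hminor (i : Fin (n + 1)) := V.det_ne_zero_and_T_det (delCol A i) (delCol At i)
    (fun r c => hne r _) (fun r c => htrop r _) (hcram i)
  have hsign (i : Fin (n + 1)) : ((-1) ^ (i : ℕ) : K) ≠ 0 :=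
    pow_ne_zero _ (neg_ne_zero.mpr one_ne_zero)
  have hm (i : Fin (n + 1)) : signedMinors At i ≠ 0 := mul_ne_zero (hsign i) (hminor i).1
  refine ⟨finrank_eq_one_iff'.mpr ⟨⟨signedMinors At, mulVec_signedMinors At⟩, ?_, ?_⟩, ?_⟩
  · exact fun h => hm 0 (congrFun (congrArg Subtype.val h) 0)
  · rintro ⟨x, hx⟩
    obtain ⟨c, hc⟩ := exists_eq_smul_signedMinors At (hminor 0).1 hx
    exact ⟨c, Subtype.ext hc⟩
  · intro x hx hx0
    obtain ⟨c, rfl⟩ := exists_eq_smul_signedMinors At (hminor 0).1 hx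
    have hc : c ≠ 0 := fun h => hx0 (by rw [h, zero_smul])
    refine ⟨fun i => mul_ne_zero hc (hm i), V.T c, fun i => ?_⟩
    rw [← (hminor i).2, Pi.smul_apply, smul_eq_mul, TropValField.T,
      V.v_mul _ _ hc (hm i), signedMinors, V.v_mul _ _ (hsign i) (hminor i).1, V.v_neg_one_pow,
      TropValField.T, TropValField.T]
    ring
end

section
/- Let A be an n×(n+1) real matrix such that each of the n+1 square submatrices A^i (delete column i) is tropically regular. Then for every n×(n+1) matrix Ã over K* with T(Ã) = A: every entry of Cram_A(Pc(Ã)) is nonzero, the homogeneous system Ã·x = 0 has a one-dimensional solution space, every nonzero solution x̃ has all coordinates in K*, and there is λ ∈ 𝕋 with T(x̃_i) = |A^i|_t + λ for all i (the solution tropicalizes to the stable tropical solution [|A^1|_t : … : |A^{n+1}|_t]). -/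
open Finset

namespace TropValField

variable {K k : Type*} [Field K] [Field k] (V : TropValField K k)

theorem v_neg {x : K} (hx : x ≠ 0) : V.v (-x) = V.v x := by
  rw [← neg_one_mul, V.v_mul _ _ (neg_ne_zero.2 one_ne_zero) hx, V.v_neg_one, zero_add]

theorem v_sign {ι : Type*} [Fintype ι] [DecidableEq ι] (σ : Equiv.Perm ι) :
    V.v ((Equiv.Perm.sign σ : ℤ) : K) = 0 := by
  rcases Int.units_eq_one_or (Equiv.Perm.sign σ) with h | h <;> rw [h]
  · simpa using V.v_one
  · simpa using V.v_neg_one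

theorem v_prod {ι : Type*} (s : Finset ι) (f : ι → K) (hf : ∀ i, f i ≠ 0) :
    V.v (∏ i ∈ s, f i) = ∑ i ∈ s, V.v (f i) := by
  classical
  induction s using Finset.induction_on with
  | empty => simpa using V.v_one
  | insert a s ha ih =>
    rw [prod_insert ha, sum_insert ha, V.v_mul _ _ (hf a) (prod_ne_zero_iff.2 fun i _ => hf i), ih]

theorem sum_eq_zero_or_lt_v {ι : Type*} (s : Finset ι) (f : ι → K) (c : ℝ)
    (hf : ∀ i ∈ s, f i = 0 ∨ c < V.v (f i)) :
    ∑ i ∈ s, f i = 0 ∨ c < V.v (∑ i ∈ s, f i) := by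
  refine sum_induction f (fun y => y = 0 ∨ c < V.v y) ?_ (Or.inl rfl) hf
  intro a b ha hb
  by_cases ha0 : a = 0
  · simpa [ha0] using hb
  by_cases hb0 : b = 0
  · simpa [hb0] using ha
  by_cases hab : a + b = 0
  · exact Or.inl hab
  · exact Or.inr ((lt_min (ha.resolve_left ha0) (hb.resolve_left hb0)).trans_le
      (V.v_add a b ha0 hb0 hab))

theorem add_ne_zero_of_v_lt {x y : K} (hx : x ≠ 0) (hy : y = 0 ∨ V.v x < V.v y) :
    x + y ≠ 0 := by
  intro h
  have hyx : y = -x := (neg_eq_of_add_eq_zero_right h).symm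
  rw [hyx, V.v_neg hx] at hy
  exact hy.elim (neg_ne_zero.2 hx) (lt_irrefl _)

theorem v_add_of_v_lt {x y : K} (hx : x ≠ 0) (hy : y = 0 ∨ V.v x < V.v y) :
    V.v (x + y) = V.v x := by
  by_cases hy0 : y = 0
  · rw [hy0, add_zero]
  have hlt := hy.resolve_left hy0
  have hxy := V.add_ne_zero_of_v_lt hx hy
  have h₁ := V.v_add x y hx hy0 hxy
  have h₂ := V.v_add (x + y) (-y) hxy (neg_ne_zero.2 hy0) (by simpa using hx)
  rw [V.v_neg hy0, add_neg_cancel_right] at h₂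
  rw [min_eq_left hlt.le] at h₁
  rcases min_le_iff.1 h₂ with h | h <;> linarith

theorem Pc_ne_zero {x : K} (hx : x ≠ 0) : V.Pc x ≠ 0 := by
  have h0 : V.v (x * V.sec (-(V.v x))) = 0 := by
    rw [V.v_mul _ _ hx (V.sec_ne _), V.v_sec, add_neg_cancel]
  have hne := mul_ne_zero hx (V.sec_ne (-(V.v x)))
  rw [Pc, Ne, V.res_zero_iff _ (Or.inr h0.ge), h0]
  simp [hne]

theorem T_mul {x y : K} (hx : x ≠ 0) (hy : y ≠ 0) : V.T (x * y) = V.T x + V.T y := by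
  rw [T, T, T, V.v_mul x y hx hy, neg_add]

end TropValField

theorem sum_le_tropDet {n : ℕ} (A : Matrix (Fin n) (Fin n) ℝ) (σ : Equiv.Perm (Fin n)) :
    ∑ i, A i (σ i) ≤ tropDet A :=
  Finset.le_sup' (fun σ : Equiv.Perm (Fin n) => ∑ i, A i (σ i)) (mem_univ σ)

theorem pseudoDet_ne_zero {n : ℕ} {R : Type*} [CommRing R] [IsDomain R]
    {A : Matrix (Fin n) (Fin n) ℝ} (hA : ∃! σ : Equiv.Perm (Fin n), ∑ i, A i (σ i) = tropDet A)
    {B : Matrix (Fin n) (Fin n) R} (hB : ∀ i j, B i j ≠ 0) : pseudoDet A B ≠ 0 := by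
  classical
  obtain ⟨σ, hσ, huniq⟩ := hA
  have hfilter : univ.filter (fun τ : Equiv.Perm (Fin n) => ∑ i, A i (τ i) = tropDet A) = {σ} := by
    ext τ
    simp only [mem_filter, mem_univ, true_and, mem_singleton]
    exact ⟨huniq τ, fun h => h ▸ hσ⟩
  have hsum : pseudoDet A B = ((Equiv.Perm.sign σ : ℤ) : R) * ∏ i, B i (σ i) := by
    unfold pseudoDet
    convert Finset.sum_singleton _ σ
  rw [hsum]
  refine mul_ne_zero ?_ (prod_ne_zero_iff.2 fun i _ => hB i _)
  rcases Int.units_eq_one_or (Equiv.Perm.sign σ) with h | h <;> simp [h]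

/-- A lift of a tropically regular matrix is nonsingular, and its determinant tropicalizes to
the tropical determinant. -/
theorem det_ne_zero_and_T_det {K k : Type*} [Field K] [Field k] (V : TropValField K k) {n : ℕ}
    {A : Matrix (Fin n) (Fin n) ℝ} (hA : ∃! σ : Equiv.Perm (Fin n), ∑ i, A i (σ i) = tropDet A)
    {M : Matrix (Fin n) (Fin n) K} (hM : ∀ i j, M i j ≠ 0) (hT : ∀ i j, V.T (M i j) = A i j) :
    M.det ≠ 0 ∧ V.T M.det = tropDet A := by
  obtain ⟨σ, hσ, huniq⟩ := hA
  set f : Equiv.Perm (Fin n) → K :=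
    fun τ => ((Equiv.Perm.sign τ : ℤ) : K) * ∏ i, M i (τ i) with hf
  have hsign : ∀ τ : Equiv.Perm (Fin n), ((Equiv.Perm.sign τ : ℤ) : K) ≠ 0 := fun τ => by
    rcases Int.units_eq_one_or (Equiv.Perm.sign τ) with h | h <;> simp [h]
  have hprod : ∀ τ : Equiv.Perm (Fin n), ∏ i, M i (τ i) ≠ 0 := fun τ =>
    prod_ne_zero_iff.2 fun i _ => hM i _
  have hv : ∀ τ, V.v (f τ) = -∑ i, A i (τ i) := fun τ => by
    rw [hf, V.v_mul _ _ (hsign τ) (hprod τ), V.v_sign, V.v_prod _ _ fun i => hM i _, zero_add,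
      ← sum_neg_distrib]
    exact sum_congr rfl fun i _ => by rw [← hT, TropValField.T, neg_neg]
  have hdet : M.det = f σ + ∑ τ ∈ univ.erase σ, f τ := by
    rw [add_sum_erase _ _ (mem_univ σ), ← Matrix.det_transpose, Matrix.det_apply']
    rfl
  have hσ0 : f σ ≠ 0 := mul_ne_zero (hsign σ) (hprod σ)
  have hrest := V.sum_eq_zero_or_lt_v (univ.erase σ) f (V.v (f σ)) fun τ hτ => by
    right
    rw [hv, hv, neg_lt_neg_iff, hσ]
    exact lt_of_le_of_ne (sum_le_tropDet A τ) fun h => (mem_erase.1 hτ).1 (huniq τ h)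
  rw [hdet]
  refine ⟨V.add_ne_zero_of_v_lt hσ0 hrest, ?_⟩
  rw [TropValField.T, V.v_add_of_v_lt hσ0 hrest, hv, neg_neg, hσ]

/-- The vector of signed maximal minors lies in the kernel. -/
theorem mulVec_signed_minors_eq_zero {R : Type*} [CommRing R] {n : ℕ}
    (M : Matrix (Fin n) (Fin (n + 1)) R) :
    M.mulVec (fun j => (-1) ^ (j : ℕ) * (delCol M j).det) = 0 := by
  funext r
  let N : Matrix (Fin (n + 1)) (Fin (n + 1)) R :=
    M.submatrix (Fin.cons (α := fun _ => Fin n) r id) id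
  have hN : N.det = 0 := Matrix.det_zero_of_row_eq (Fin.succ_ne_zero r).symm rfl
  rw [Matrix.det_succ_row_zero] at hN
  rw [Pi.zero_apply, ← hN, Matrix.mulVec, dotProduct]
  refine sum_congr rfl fun j _ => ?_
  have hsub : N.submatrix Fin.succ j.succAbove = delCol M j := rfl
  have hrow : N 0 j = M r j := rfl
  rw [hsub, hrow]
  ring

/-- A kernel vector with a vanishing coordinate is zero if the complementary maximal minor is
nonzero. -/
theorem eq_zero_of_mulVec_eq_zero_of_apply_eq_zero {K : Type*} [Field K] {n : ℕ}
    {M : Matrix (Fin n) (Fin (n + 1)) K} {i : Fin (n + 1)} (hdet : (delCol M i).det ≠ 0)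
    {x : Fin (n + 1) → K} (hx : M.mulVec x = 0) (hi : x i = 0) : x = 0 := by
  have h : (delCol M i).mulVec (fun j => x (i.succAbove j)) = 0 := by
    funext r
    have hr := congrFun hx r
    simp only [Matrix.mulVec, dotProduct] at hr ⊢
    rw [Fin.sum_univ_succAbove _ i, hi, mul_zero, zero_add] at hr
    exact hr
  have h0 := Matrix.eq_zero_of_mulVec_eq_zero hdet h
  funext j
  rcases Fin.eq_self_or_eq_succAbove i j with rfl | ⟨l, rfl⟩
  · exact hi
  · exact congrFun h0 l

/-- if every maximal square submatrix `A^i` of `A` is tropically regular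
(the tropical determinant is attained by exactly one permutation), then for every lift `Ã`
of `A` all pseudodeterminant entries of `Cram_A(Pc Ã)` are nonzero, the system `Ã x = 0`
has a unique projective solution with coordinates in `K*`, and it tropicalizes to the
stable tropical solution `[|A^1|_t : … : |A^{n+1}|_t]`. -/
theorem tropical_cramer_regular
    {K k : Type*} [Field K] [IsAlgClosed K] [Field k] (V : TropValField K k)
    {n : ℕ} (A : Matrix (Fin n) (Fin (n + 1)) ℝ)
    (hreg : ∀ i : Fin (n + 1),
      ∃! σ : Equiv.Perm (Fin n), ∑ r, delCol A i r (σ r) = tropDet (delCol A i)) :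
    ∀ At : Matrix (Fin n) (Fin (n + 1)) K,
      (∀ r c, At r c ≠ 0) → (∀ r c, V.T (At r c) = A r c) →
      (∀ i : Fin (n + 1),
        pseudoDet (delCol A i) (delCol (fun r c => V.Pc (At r c)) i) ≠ 0) ∧
      Module.finrank K ↥(LinearMap.ker At.mulVecLin) = 1 ∧
      ∀ x : Fin (n + 1) → K, At.mulVec x = 0 → x ≠ 0 →
        (∀ i, x i ≠ 0) ∧ ∃ lam : ℝ, ∀ i, V.T (x i) = tropDet (delCol A i) + lam := by
  intro At hne hT
  have hminor := fun i => det_ne_zero_and_T_det V (hreg i) (M := delCol At i)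
    (fun r c => hne r _) (fun r c => hT r _)
  set w : Fin (n + 1) → K := fun j => (-1) ^ (j : ℕ) * (delCol At j).det with hw
  have hpow : ∀ j : Fin (n + 1), ((-1 : K)) ^ (j : ℕ) ≠ 0 := fun j =>
    pow_ne_zero _ (neg_ne_zero.2 one_ne_zero)
  have hw0 : ∀ j, w j ≠ 0 := fun j => mul_ne_zero (hpow j) (hminor j).1
  have hTw : ∀ j, V.T (w j) = tropDet (delCol A j) := fun j => by
    rw [hw, V.T_mul (hpow j) (hminor j).1, (hminor j).2, TropValField.T, V.v_neg_one_pow,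
      neg_zero, zero_add]
  have hker : At.mulVec w = 0 := mulVec_signed_minors_eq_zero At
  have hspan : ∀ x : Fin (n + 1) → K, At.mulVec x = 0 → (x 0 / w 0) • w = x := fun x hx => by
    refine sub_eq_zero.1 (eq_zero_of_mulVec_eq_zero_of_apply_eq_zero (hminor 0).1 ?_ ?_)
    · rw [Matrix.mulVec_sub, Matrix.mulVec_smul, hker, hx, smul_zero, sub_zero]
    · simp [div_mul_cancel₀ _ (hw0 0)]
  refine ⟨fun i => pseudoDet_ne_zero (hreg i) fun r c => V.Pc_ne_zero (hne r _), ?_, ?_⟩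
  · refine finrank_eq_one (⟨w, hker⟩ : LinearMap.ker At.mulVecLin) ?_ ?_
    · exact fun h => hw0 0 (congrFun (congrArg Subtype.val h) 0)
    · exact fun x => ⟨x.1 0 / w 0, Subtype.ext (hspan x.1 x.2)⟩
  · intro x hx hx0
    have hxi : ∀ i, x i ≠ 0 := fun i hi =>
      hx0 (eq_zero_of_mulVec_eq_zero_of_apply_eq_zero (hminor i).1 hx hi)
    refine ⟨hxi, V.T (x 0 / w 0), fun i => ?_⟩
    have hi : x i = x 0 / w 0 * w i := (congrFun (hspan x hx) i).symm
    rw [hi, V.T_mul (div_ne_zero (hxi 0) (hw0 0)) (hw0 i), hTw, add_comm]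
end

section
/- (The stable curve through residually generic points is residually generic.) Let k be an algebraically closed field, let I = {l₀, l₁, …, l_{δ−1}} ⊆ ℕ² be a finite support with δ elements, and let q₁,…,q_{δ−1} ∈ ℝ² be arbitrary points. Let A be the (δ−1)×δ real matrix with entry i₁q_j¹ + i₂q_j² in row j, column i = (i₁,i₂) ∈ I, and let M be the (δ−1)×δ matrix over the polynomial ring k[γ_j¹, γ_j² : 1 ≤ j ≤ δ−1] (in 2δ−2 variables) whose entry in row j, column i is the monomial (γ_j¹)^{i₁}(γ_j²)^{i₂}. Then each pseudodeterminant Δ_{A^{l}}(M^{l}) (l ∈ I) is a nonzero polynomial, and the δ−1 rational functions Δ_{A^{l_i}}(M^{l_i}) / Δ_{A^{l₀}}(M^{l₀}), 1 ≤ i ≤ δ−1, are algebraically independent over k in the fraction field k(γ_j¹, γ_j²); equivalently, the rational map k^{2δ−2} ⇢ k^{δ−1} given by these pseudodeterminant ratios is dominant, i.e. its image is Zariski dense in k^{δ−1}. -/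
open Finset

section Pseudodeterminant

variable {R : Type*} [CommRing R]

/-- The matrix `t ^ A * B`, with real exponents, over the group algebra of `ℝ`. -/
noncomputable def tropLift {m n : ℕ} (A : Matrix (Fin m) (Fin n) ℝ) (B : Matrix (Fin m) (Fin n) R) :
    Matrix (Fin m) (Fin n) (AddMonoidAlgebra R ℝ) :=
  Matrix.of fun i j => AddMonoidAlgebra.single (A i j) (B i j)

open Classical in
theorem coeff_det_tropLift {n : ℕ} (A : Matrix (Fin n) (Fin n) ℝ) (B : Matrix (Fin n) (Fin n) R)
    (w : ℝ) :
    (tropLift A B).det.coeff w =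
      ∑ σ ∈ Finset.univ.filter (fun σ : Equiv.Perm (Fin n) => ∑ i, A i (σ i) = w),
        ((Equiv.Perm.sign σ : ℤ) : R) * ∏ i, B i (σ i) := by
  rw [← Matrix.det_transpose, Matrix.det_apply, AddMonoidAlgebra.coeff_sum, Finsupp.finsetSum_apply,
    Finset.sum_filter]
  refine Finset.sum_congr rfl fun σ _ => ?_
  simp only [tropLift, Matrix.transpose_apply, Matrix.of_apply, AddMonoidAlgebra.prod_single]
  rcases Int.units_eq_one_or (Equiv.Perm.sign σ) with h | h <;>
    simp [h, Finsupp.single_apply]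
  split_ifs <;> simp

theorem coeff_det_tropLift_tropDet {n : ℕ} (A : Matrix (Fin n) (Fin n) ℝ)
    (B : Matrix (Fin n) (Fin n) R) :
    (tropLift A B).det.coeff (tropDet A) = pseudoDet A B :=
  coeff_det_tropLift A B _

theorem coeff_det_tropLift_of_lt {n : ℕ} (A : Matrix (Fin n) (Fin n) ℝ)
    (B : Matrix (Fin n) (Fin n) R) {w : ℝ} (hw : tropDet A < w) :
    (tropLift A B).det.coeff w = 0 := by
  classical
  rw [coeff_det_tropLift, Finset.filter_false_of_mem, Finset.sum_empty]
  rintro σ - rfl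
  exact hw.not_ge (Finset.le_sup' (fun σ : Equiv.Perm (Fin n) => ∑ i, A i (σ i))
    (Finset.mem_univ σ))

theorem sum_tropLift_mul_det_delCol {d : ℕ} (A : Matrix (Fin d) (Fin (d + 1)) ℝ)
    (B : Matrix (Fin d) (Fin (d + 1)) R) (j : Fin d) :
    ∑ i : Fin (d + 1), (-1) ^ (i : ℕ) * tropLift A B j i *
      (tropLift (delCol A i) (delCol B i)).det = 0 := by
  let N : Matrix (Fin (d + 1)) (Fin (d + 1)) (AddMonoidAlgebra R ℝ) :=
    Matrix.of (Fin.cons (tropLift A B j) (tropLift A B))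
  have h : N.det = 0 := Matrix.det_zero_of_row_eq (Fin.succ_ne_zero j).symm rfl
  rw [Matrix.det_succ_row_zero] at h
  exact h

/-- The tropical Cramer relation: on the columns where `A j i + |A^i|_t` is maximal, the signed
pseudodeterminants give a linear relation between the entries of row `j`. -/
theorem exists_sum_pseudoDet_delCol_mul_eq_zero {d : ℕ} (A : Matrix (Fin d) (Fin (d + 1)) ℝ)
    (B : Matrix (Fin d) (Fin (d + 1)) R) (j : Fin d) :
    ∃ T : Finset (Fin (d + 1)), T.Nonempty ∧
      ∑ i ∈ T, (-1) ^ (i : ℕ) * B j i * pseudoDet (delCol A i) (delCol B i) = 0 := by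
  classical
  obtain ⟨i₀, -, hi₀⟩ := Finset.exists_max_image Finset.univ
    (fun i => A j i + tropDet (delCol A i)) Finset.univ_nonempty
  set m := A j i₀ + tropDet (delCol A i₀)
  refine ⟨Finset.univ.filter fun i => A j i + tropDet (delCol A i) = m, ⟨i₀, by simp [m]⟩, ?_⟩
  have h := congrArg (fun f => f.coeff m) (sum_tropLift_mul_det_delCol A B j)
  simp only [AddMonoidAlgebra.coeff_sum, Finsupp.finsetSum_apply, AddMonoidAlgebra.coeff_zero,
    Finsupp.coe_zero, Pi.zero_apply] at h
  rw [Finset.sum_filter]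
  refine (Finset.sum_congr rfl fun i _ => ?_).trans h
  have key : ((-1) ^ (i : ℕ) * tropLift A B j i *
      (tropLift (delCol A i) (delCol B i)).det).coeff m =
      (-1) ^ (i : ℕ) * B j i * (tropLift (delCol A i) (delCol B i)).det.coeff (-A j i + m) := by
    rcases Nat.even_or_odd (i : ℕ) with h | h <;>
    simp [h, tropLift]
  rw [key]
  split_ifs with hi
  · rw [← hi, neg_add_cancel_left, coeff_det_tropLift_tropDet]
  · have hlt := lt_of_le_of_ne (hi₀ i (Finset.mem_univ i)) hi
    rw [coeff_det_tropLift_of_lt _ _ (by linarith), mul_zero]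

end Pseudodeterminant

theorem pseudoDet_monomial_ne_zero {k : Type*} [CommRing k] [Nontrivial k] {d : ℕ}
    (A : Matrix (Fin d) (Fin d) ℝ) (e : Fin d → ℕ × ℕ) (he : Function.Injective e) :
    pseudoDet A (fun j i => (MvPolynomial.X (j, 0) ^ (e i).1 * MvPolynomial.X (j, 1) ^ (e i).2 :
      MvPolynomial (Fin d × Fin 2) k)) ≠ 0 := by
  classical
  obtain ⟨σ₀, -, hσ₀⟩ := Finset.exists_mem_eq_sup' (s := Finset.univ) ⟨1, Finset.mem_univ 1⟩
    (fun σ : Equiv.Perm (Fin d) => ∑ i, A i (σ i))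
  let m : Equiv.Perm (Fin d) → (Fin d × Fin 2 →₀ ℕ) := fun σ =>
    Finsupp.equivFunOnFinite.symm fun p => ![(e (σ p.1)).1, (e (σ p.1)).2] p.2
  have hm : Function.Injective m := by
    intro σ τ h
    ext j : 1
    apply he
    have h' := fun s : Fin 2 => DFunLike.congr_fun h (j, s)
    exact Prod.ext (by simpa [m] using h' 0) (by simpa [m] using h' 1)
  have hprod : ∀ σ : Equiv.Perm (Fin d), ∏ j, (MvPolynomial.X (j, 0) ^ (e (σ j)).1 *
      MvPolynomial.X (j, 1) ^ (e (σ j)).2 : MvPolynomial (Fin d × Fin 2) k) =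
      MvPolynomial.monomial (m σ) 1 := by
    intro σ
    rw [MvPolynomial.monomial_eq, Finsupp.prod_fintype _ _ (by simp), Fintype.prod_prod_type]
    simp [m]
  intro h
  have h' := congrArg (MvPolynomial.coeff (m σ₀)) h
  simp only [pseudoDet, hprod] at h'
  rw [MvPolynomial.coeff_sum, Finset.sum_eq_single σ₀] at h'
  · rcases Int.units_eq_one_or (Equiv.Perm.sign σ₀) with h1 | h1 <;> simp [h1] at h'
  · intro σ _ hσ
    have := hm.ne hσ
    rcases Int.units_eq_one_or (Equiv.Perm.sign σ) with h1 | h1 <;>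
      simp [h1, MvPolynomial.coeff_monomial, this]
  · intro h1
    exact (h1 (Finset.mem_filter.2 ⟨Finset.mem_univ _, hσ₀.symm⟩)).elim

section AlgebraicIndependence

variable {k K : Type*} [Field k] [Field K] [Algebra k K]

theorem exists_isAlgebraic_of_not_algebraicIndependent (S₀ : Subalgebra k K) (x : Fin 2 → K)
    (h : ¬ AlgebraicIndependent S₀ x) :
    ∃ s, ∀ S : Subalgebra k K, S₀ ≤ S → x s ∈ S → ∀ t, IsAlgebraic S (x t) := by
  have mem (S : Subalgebra k K) {y : K} (hy : y ∈ S) : IsAlgebraic S y :=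
    isAlgebraic_algebraMap (⟨y, hy⟩ : S)
  rw [AlgebraicIndependent.iff_transcendental_adjoin_image 0, not_and_or] at h
  rcases h with h | h
  · let u : Unique {j : Fin 2 // j ≠ 0} := ⟨⟨⟨1, by decide⟩⟩, fun a => Subtype.ext (by
      have := a.2; change a.1 = 1; omega)⟩
    rw [algebraicIndependent_unique_type_iff, Transcendental, not_not] at h
    refine ⟨0, fun S hS hx t => ?_⟩
    fin_cases t
    · exact mem S hx
    · exact h.tower_top_of_subalgebra_le hS
  · rw [Transcendental, not_not] at h
    refine ⟨1, fun S hS hx t => ?_⟩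
    fin_cases t
    · have hle : (Algebra.adjoin S₀ (x '' {0}ᶜ)).restrictScalars k ≤ S := by
        rw [Algebra.restrictScalars_adjoin]
        refine Algebra.adjoin_le (Set.union_subset hS ?_)
        rintro _ ⟨i, hi, rfl⟩
        have : i = 1 := by
          have : i ≠ 0 := hi
          lia
        exact this ▸ hx
      have h' : IsAlgebraic ((Algebra.adjoin S₀ (x '' {0}ᶜ)).restrictScalars k) (x 0) := h
      exact h'.tower_top_of_subalgebra_le hle
    · exact mem S hx

/-- If `K` has a transcendence basis made of `d` pairs, each of which is algebraically dependent
over the algebra generated by `c₁, …, c_d`, then the `c_i` are algebraically independent. -/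
theorem algebraicIndependent_of_pairs {d : ℕ} {x : Fin d × Fin 2 → K}
    (hx : IsTranscendenceBasis k x) (c : Fin d → K)
    (h : ∀ j, ¬ AlgebraicIndependent (Algebra.adjoin k (Set.range c)) fun s => x (j, s)) :
    AlgebraicIndependent k c := by
  choose s hs using fun j => exists_isAlgebraic_of_not_algebraicIndependent _ _ (h j)
  let y : Fin d ⊕ Fin d → K := Sum.elim c fun j => x (j, s j)
  have : Algebra.IsAlgebraic (Algebra.adjoin k (Set.range y)) K :=
    hx.isAlgebraic_iff.2 fun p => hs p.1 _
      (Algebra.adjoin_mono (by rintro _ ⟨i, rfl⟩; exact Set.mem_range_self (f := y) (Sum.inl i)))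
      (Algebra.subset_adjoin (Set.mem_range_self (f := y) (Sum.inr p.1))) p.2
  have hy : IsTranscendenceBasis k y := by
    refine Algebra.IsAlgebraic.isTranscendenceBasis_of_lift_le_trdeg_of_finite k y ?_
    rw [← hx.lift_cardinalMk_eq_trdeg]
    simp [mul_two]
  exact hy.1.comp Sum.inl Sum.inl_injective

end AlgebraicIndependence

/-- the stable curve through residually generic points is residually generic.
Here `ι` enumerates the support `I = {l₀, …, l_δ₋₁} ⊆ ℕ²` (with `l₀ = ι 0`, `δ = d + 1`),
`q` are the `δ − 1` tropical points, `A` is the tropical coefficient matrix and `M` is the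
matrix of generic monomials `(γ_j¹)^{i₁} (γ_j²)^{i₂}` over the polynomial ring
`k[γ_j¹, γ_j²]` in `2δ − 2` variables.  All pseudodeterminants `Δ_{A^l}(M^l)` are nonzero
polynomials, and the `δ − 1` pseudodeterminant ratios are algebraically independent over
`k` in the fraction field — equivalently, the associated rational map
`k^{2δ−2} ⇢ k^{δ−1}` is dominant. -/
theorem stable_curve_residually_generic
    {k : Type*} [Field k] [IsAlgClosed k] {d : ℕ}
    (ι : Fin (d + 1) → ℕ × ℕ) (hι : Function.Injective ι)
    (q : Fin d → ℝ × ℝ)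
    (A : Matrix (Fin d) (Fin (d + 1)) ℝ)
    (hA : ∀ j i, A j i = ((ι i).1 : ℝ) * (q j).1 + ((ι i).2 : ℝ) * (q j).2)
    (M : Matrix (Fin d) (Fin (d + 1)) (MvPolynomial (Fin d × Fin 2) k))
    (hM : ∀ j i, M j i =
      MvPolynomial.X (j, 0) ^ (ι i).1 * MvPolynomial.X (j, 1) ^ (ι i).2) :
    (∀ l : Fin (d + 1), pseudoDet (delCol A l) (delCol M l) ≠ 0) ∧
    AlgebraicIndependent k (fun i : Fin d =>
      (algebraMap (MvPolynomial (Fin d × Fin 2) k)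
          (FractionRing (MvPolynomial (Fin d × Fin 2) k))
          (pseudoDet (delCol A i.succ) (delCol M i.succ))) /
      (algebraMap (MvPolynomial (Fin d × Fin 2) k)
          (FractionRing (MvPolynomial (Fin d × Fin 2) k))
          (pseudoDet (delCol A 0) (delCol M 0)))) := by
  have hne : ∀ l : Fin (d + 1), pseudoDet (delCol A l) (delCol M l) ≠ 0 := by
    intro l
    have := pseudoDet_monomial_ne_zero (k := k) (delCol A l) (fun i => ι (l.succAbove i))
      (hι.comp Fin.succAbove_right_injective)
    rwa [show delCol M l = fun j i => _ from funext₂ fun j i => hM j (l.succAbove i)]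
  refine ⟨hne, ?_⟩
  set φ := algebraMap (MvPolynomial (Fin d × Fin 2) k)
    (FractionRing (MvPolynomial (Fin d × Fin 2) k))
  have hinj : Function.Injective φ := IsFractionRing.injective _ _
  set Δ : Fin (d + 1) → FractionRing (MvPolynomial (Fin d × Fin 2) k) :=
    fun l => φ (pseudoDet (delCol A l) (delCol M l)) with hΔ
  have hΔne : ∀ l, Δ l ≠ 0 := fun l => (map_ne_zero_iff φ hinj).2 (hne l)
  have : Algebra.IsAlgebraic (MvPolynomial (Fin d × Fin 2) k)
      (FractionRing (MvPolynomial (Fin d × Fin 2) k)) :=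
    (IsFractionRing.isAlgebraic_iff' _ (MvPolynomial (Fin d × Fin 2) k) _).1 inferInstance
  have hx : IsTranscendenceBasis k (φ ∘ (MvPolynomial.X : Fin d × Fin 2 → _)) :=
    (IsTranscendenceBasis.mvPolynomial (Fin d × Fin 2) k).algebraMap_comp
  refine algebraicIndependent_of_pairs hx _ fun j hj => ?_
  set S := Algebra.adjoin k (Set.range fun i : Fin d => Δ i.succ / Δ 0)
  have hmem : ∀ i, Δ i / Δ 0 ∈ S := by
    intro i
    induction i using Fin.cases with
    | zero => rw [div_self (hΔne 0)]; exact one_mem S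
    | succ i => exact Algebra.subset_adjoin ⟨i, rfl⟩
  obtain ⟨T, ⟨i₀, hi₀⟩, hT⟩ := exists_sum_pseudoDet_delCol_mul_eq_zero A M j
  let e : Fin (d + 1) → (Fin 2 →₀ ℕ) := fun i =>
    Finsupp.equivFunOnFinite.symm ![(ι i).1, (ι i).2]
  have he : Function.Injective e := by
    intro a b hab
    have h' := fun s : Fin 2 => DFunLike.congr_fun hab s
    exact hι (Prod.ext (by simpa [e] using h' 0) (by simpa [e] using h' 1))
  let p : MvPolynomial (Fin 2) S :=
    ∑ i ∈ T, MvPolynomial.monomial (e i) ((-1) ^ (i : ℕ) * ⟨Δ i / Δ 0, hmem i⟩)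
  have hp : MvPolynomial.aeval (fun s => (φ ∘ MvPolynomial.X) (j, s)) p = 0 := by
    have h := congrArg (fun f => φ f / Δ 0) hT
    simp only [map_sum, map_zero, zero_div, Finset.sum_div] at h
    rw [map_sum, ← h]
    refine Finset.sum_congr rfl fun i _ => ?_
    rw [MvPolynomial.aeval_monomial, Finsupp.prod_fintype _ _ (by simp), hM]
    simp [e, hΔ]
    ring
  have hp0 : p = 0 := (algebraicIndependent_iff.1 hj) p hp
  have hcoeff := congrArg (MvPolynomial.coeff (e i₀)) hp0
  rw [MvPolynomial.coeff_sum, Finset.sum_eq_single i₀ (fun i _ hi => by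
    simp [MvPolynomial.coeff_monomial, he.ne hi]) (fun h => (h hi₀).elim)] at hcoeff
  simp [MvPolynomial.coeff_monomial, Subtype.ext_iff, hΔne] at hcoeff
end

section
/- Let p ∈ ℝ² and let L₁, L₂, L₃, L₄ be four tropical lines in ℝ² (each given by a coefficient vector in ℝ³) such that p ∈ L_i for all i = 1,2,3,4. Then there exist indices i ≠ j such that the intersection L_i ∩ L_j is an infinite set. -/
/-- The maximum of the finite family `f` is attained for at least two indices. -/
def attainedTwice {n : ℕ} (f : Fin n → ℝ) : Prop :=
  ∃ i j : Fin n, i ≠ j ∧ f i = f j ∧ ∀ l, f l ≤ f i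

/-- The tropical line with coefficient vector `(α, β, γ)`: the set of points `(x, y)` where
`max (α + x) (β + y) γ` is attained at least twice. -/
def tropLineSet (a : ℝ × ℝ × ℝ) : Set (ℝ × ℝ) :=
  {p | attainedTwice ![a.1 + p.1, a.2.1 + p.2, a.2.2]}

/-- The three ray directions of a tropical line. -/
def tropDirection : Fin 3 → ℝ × ℝ :=
  ![(-1, 0), (0, -1), (1, 1)]

theorem tropDirection_ne_zero (k : Fin 3) : tropDirection k ≠ 0 := by
  fin_cases k <;> simp [tropDirection]

theorem mem_tropLineSet_iff (a : ℝ × ℝ × ℝ) (p : ℝ × ℝ) :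
    p ∈ tropLineSet a ↔
      (a.2.1 + p.2 = a.2.2 ∧ a.1 + p.1 ≤ a.2.2) ∨
      (a.1 + p.1 = a.2.2 ∧ a.2.1 + p.2 ≤ a.2.2) ∨
      (a.1 + p.1 = a.2.1 + p.2 ∧ a.2.2 ≤ a.2.1 + p.2) := by
  simp only [tropLineSet, attainedTwice, Set.mem_ofPred_eq, Fin.exists_fin_succ, Fin.forall_fin_succ]
  simp
  grind

/-- A tropical line through `p` contains a whole ray from `p` in one of the three directions. -/
theorem exists_ray_subset_tropLineSet {a : ℝ × ℝ × ℝ} {p : ℝ × ℝ} (hp : p ∈ tropLineSet a) :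
    ∃ k : Fin 3, ∀ t : ℝ, 0 ≤ t → p + t • tropDirection k ∈ tropLineSet a := by
  simp only [mem_tropLineSet_iff] at hp ⊢
  rcases hp with h | h | h
  · refine ⟨0, fun t ht => Or.inl ?_⟩
    simp [tropDirection]
    constructor <;> linarith
  · refine ⟨1, fun t ht => Or.inr (Or.inl ?_)⟩
    simp [tropDirection]
    constructor <;> linarith
  · refine ⟨2, fun t ht => Or.inr (Or.inr ?_)⟩
    simp [tropDirection]
    constructor <;> linarith

/-- if four tropical lines pass through a common point, then two of them have
infinite intersection. -/
theorem four_concurrent_tropical_lines_two_meet_infinitely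
    (L : Fin 4 → ℝ × ℝ × ℝ) (p : ℝ × ℝ) (h : ∀ i, p ∈ tropLineSet (L i)) :
    ∃ i j : Fin 4, i ≠ j ∧ (tropLineSet (L i) ∩ tropLineSet (L j)).Infinite := by
  choose k hk using fun i => exists_ray_subset_tropLineSet (h i)
  obtain ⟨i, j, hij, hkij⟩ := Fintype.exists_ne_map_eq_of_card_lt k (by simp)
  refine ⟨i, j, hij, ?_⟩
  have hinj : Function.Injective fun t : ℝ => p + t • tropDirection (k i) :=
    (add_right_injective p).comp (smul_left_injective ℝ (tropDirection_ne_zero (k i)))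
  refine ((Set.Ici_infinite (0 : ℝ)).image hinj.injOn).mono ?_
  rintro _ ⟨t, ht, rfl⟩
  exact ⟨hk i t ht, by simpa only [hkij] using hk j t ht⟩
end

section
/- Let α, β ∈ ℝ³ be coefficient vectors of tropical lines L₁, L₂ such that L₁ ∩ L₂ consists of exactly one point p ∈ ℝ². Let α̃ = (α̃₁,α̃₂,α̃₃), β̃ ∈ (K*)³ be any lifts with T(α̃_i) = α_i and T(β̃_i) = β_i for i = 1,2,3. Then every common solution (x̃,ỹ) ∈ (K*)² of the two algebraic equations α̃₁x + α̃₂y + α̃₃ = 0 and β̃₁x + β̃₂y + β̃₃ = 0 satisfies T(x̃,ỹ) = p. -/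
/-- An algebraically closed field `K` equipped with a nontrivial rank-one valuation
`v : K* → ℝ` (the value of `0` is irrelevant). -/
structure RankOneVal (K : Type*) [Field K] where
  v : K → ℝ
  v_mul : ∀ x y : K, x ≠ 0 → y ≠ 0 → v (x * y) = v x + v y
  v_add : ∀ x y : K, x ≠ 0 → y ≠ 0 → x + y ≠ 0 → min (v x) (v y) ≤ v (x + y)
  v_nontrivial : ∃ x : K, x ≠ 0 ∧ v x ≠ 0

/-- The tropicalization map `T x = -v x`. -/
def RankOneVal.T {K : Type*} [Field K] (V : RankOneVal K) (x : K) : ℝ := -(V.v x)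

theorem RankOneVal.v_neg {K : Type*} [Field K] (V : RankOneVal K) {x : K} (hx : x ≠ 0) :
    V.v (-x) = V.v x := by
  have one : V.v 1 = 0 := by
    have h := V.v_mul 1 1 one_ne_zero one_ne_zero
    rw [mul_one] at h
    linarith
  have neg_one : V.v (-1) = 0 := by
    have h := V.v_mul (-1) (-1) (neg_ne_zero.mpr one_ne_zero) (neg_ne_zero.mpr one_ne_zero)
    rw [neg_mul_neg, mul_one, one] at h
    linarith
  have h := V.v_mul (-1) x (neg_ne_zero.mpr one_ne_zero) hx
  rwa [neg_one_mul, neg_one, zero_add] at h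

theorem RankOneVal.T_mul {K : Type*} [Field K] (V : RankOneVal K) {x y : K}
    (hx : x ≠ 0) (hy : y ≠ 0) : V.T (x * y) = V.T x + V.T y := by
  simp only [RankOneVal.T, V.v_mul x y hx hy, neg_add]

theorem RankOneVal.T_le_max_of_add_eq_zero {K : Type*} [Field K] (V : RankOneVal K) {x y z : K}
    (hx : x ≠ 0) (hy : y ≠ 0) (hz : z ≠ 0) (h : x + y + z = 0) :
    V.T z ≤ max (V.T x) (V.T y) := by
  have hxy : x + y = -z := eq_neg_of_add_eq_zero_left h
  have hmin := V.v_add x y hx hy (hxy ▸ neg_ne_zero.mpr hz)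
  rw [hxy, V.v_neg hz] at hmin
  simpa only [RankOneVal.T, max_neg_neg, neg_le_neg_iff] using hmin

theorem attainedTwice_of_le_max {r s t : ℝ} (hr : r ≤ max s t) (hs : s ≤ max t r)
    (ht : t ≤ max r s) : attainedTwice ![r, s, t] := by
  have key : (r = s ∧ t ≤ r) ∨ (s = t ∧ r ≤ s) ∨ (t = r ∧ s ≤ t) := by
    rw [le_max_iff] at hr hs ht
    rcases le_total r s with h₁ | h₁ <;> rcases le_total s t with h₂ | h₂ <;>
      rcases le_total t r with h₃ | h₃ <;> grind
  rcases key with ⟨h, h'⟩ | ⟨h, h'⟩ | ⟨h, h'⟩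
  · exact ⟨0, 1, by decide, h, Fin.forall_fin_succ.mpr ⟨le_rfl, Fin.forall_fin_two.mpr ⟨h.ge, h'⟩⟩⟩
  · exact ⟨1, 2, by decide, h, Fin.forall_fin_succ.mpr ⟨h', Fin.forall_fin_two.mpr ⟨le_rfl, h.ge⟩⟩⟩
  · exact ⟨2, 0, by decide, h, Fin.forall_fin_succ.mpr ⟨h.ge, Fin.forall_fin_two.mpr ⟨h', le_rfl⟩⟩⟩

/-- A torus point of an algebraic line tropicalizes into the tropical line. -/
theorem RankOneVal.T_mem_tropLineSet {K : Type*} [Field K] (V : RankOneVal K)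
    {a₁ a₂ a₃ x y : K} (h₁ : a₁ ≠ 0) (h₂ : a₂ ≠ 0) (h₃ : a₃ ≠ 0) (hx : x ≠ 0) (hy : y ≠ 0)
    (h : a₁ * x + a₂ * y + a₃ = 0) :
    (V.T x, V.T y) ∈ tropLineSet (V.T a₁, V.T a₂, V.T a₃) := by
  have h₁x := mul_ne_zero h₁ hx
  have h₂y := mul_ne_zero h₂ hy
  simp only [tropLineSet, Set.mem_ofPred_eq, ← V.T_mul h₁ hx, ← V.T_mul h₂ hy]
  exact attainedTwice_of_le_max
    (V.T_le_max_of_add_eq_zero h₂y h₃ h₁x (by linear_combination h))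
    (V.T_le_max_of_add_eq_zero h₃ h₁x h₂y (by linear_combination h))
    (V.T_le_max_of_add_eq_zero h₁x h₂y h₃ h)

/-- if two tropical lines meet in exactly one point `p`, then for any lifts of
their coefficient vectors, every common solution in the torus tropicalizes to `p`. -/
theorem unique_tropical_intersection_lifts
    {K : Type*} [Field K] [IsAlgClosed K] (V : RankOneVal K)
    (a b : ℝ × ℝ × ℝ) (p : ℝ × ℝ)
    (hsingle : tropLineSet a ∩ tropLineSet b = {p})
    (a1 a2 a3 b1 b2 b3 : K)
    (ha1 : a1 ≠ 0) (ha2 : a2 ≠ 0) (ha3 : a3 ≠ 0)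
    (hb1 : b1 ≠ 0) (hb2 : b2 ≠ 0) (hb3 : b3 ≠ 0)
    (haT1 : V.T a1 = a.1) (haT2 : V.T a2 = a.2.1) (haT3 : V.T a3 = a.2.2)
    (hbT1 : V.T b1 = b.1) (hbT2 : V.T b2 = b.2.1) (hbT3 : V.T b3 = b.2.2) :
    ∀ x y : K, x ≠ 0 → y ≠ 0 →
      a1 * x + a2 * y + a3 = 0 → b1 * x + b2 * y + b3 = 0 →
      (V.T x, V.T y) = p := by
  intro x y hx hy ha hb
  have hmem : (V.T x, V.T y) ∈ tropLineSet a ∩ tropLineSet b := by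
    constructor
    · simpa only [haT1, haT2, haT3] using V.T_mem_tropLineSet ha1 ha2 ha3 hx hy ha
    · simpa only [hbT1, hbT2, hbT3] using V.T_mem_tropLineSet hb1 hb2 hb3 hx hy hb
  rwa [hsingle] at hmem
end

section
/- (Failure of lifting for a non-admissible construction.) Let a = (0,0), b = (−2,1), c = (−1,3) ∈ ℝ². Then: (i) the stable tropical line through a and b has coefficient vector L(a,b) = (1,0,1) and the stable tropical line through a and c has coefficient vector L(a,c) = (3,0,3), and a lies on both of these tropical lines; (ii) the stable intersection point M(L(a,b), L(a,c)) = (0,1), which differs from a; (iii) over K, for all lifts ã, b̃, c̃ ∈ (K*)² with T(ã) = a, T(b̃) = b, T(c̃) = c, and for any algebraic line ℓ̃₁ through ã and b̃ and any algebraic line ℓ̃₂ through ã and c̃ with ℓ̃₁ ≠ ℓ̃₂ (distinct zero sets), the set of common points of ℓ̃₁ and ℓ̃₂ is exactly {ã}, whose tropicalization is (0,0) ≠ (0,1); hence no lift of the input makes the algebraic construction (line through a,b; line through a,c; their intersection point) tropicalize to the output of the corresponding tropical construction. -/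
/-- Tropical Cramer rule: coefficient vector of the stable tropical line through two points. -/
noncomputable def Ltrop (p q : ℝ × ℝ) : ℝ × ℝ × ℝ :=
  (max p.2 q.2, max p.1 q.1, max (p.1 + q.2) (p.2 + q.1))

/-- Tropical Cramer rule: the stable intersection point of two tropical lines. -/
noncomputable def Mtrop (a b : ℝ × ℝ × ℝ) : ℝ × ℝ :=
  (max (a.2.1 + b.2.2) (a.2.2 + b.2.1) - max (a.1 + b.2.1) (a.2.1 + b.1),
   max (a.1 + b.2.2) (a.2.2 + b.1) - max (a.1 + b.2.1) (a.2.1 + b.1))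

/-- The algebraic line `ux + wy + z = 0` in the torus `(K*)²`. -/
def algLineSet {K : Type*} [Field K] (u w z : K) : Set (K × K) :=
  {p | p.1 ≠ 0 ∧ p.2 ≠ 0 ∧ u * p.1 + w * p.2 + z = 0}

/-- Two lines through a common point with proportional normal vectors: the zero set of the
first (nonzero) one is contained in the zero set of the second. -/
theorem algLineSet_subset_of_mul_eq_mul {K : Type*} [Field K] {u₁ w₁ z₁ u₂ w₂ z₂ : K} {p : K × K}
    (h₀ : ¬(u₁ = 0 ∧ w₁ = 0 ∧ z₁ = 0))
    (h₁ : u₁ * p.1 + w₁ * p.2 + z₁ = 0) (h₂ : u₂ * p.1 + w₂ * p.2 + z₂ = 0)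
    (h : u₁ * w₂ = u₂ * w₁) : algLineSet u₁ w₁ z₁ ⊆ algLineSet u₂ w₂ z₂ := by
  rintro r ⟨hr₁, hr₂, hr⟩
  refine ⟨hr₁, hr₂, ?_⟩
  by_cases hu : u₁ = 0
  · by_cases hw : w₁ = 0
    · exact absurd ⟨hu, hw, by simpa [hu, hw] using h₁⟩ h₀
    · apply (mul_eq_zero_iff_left hw).1
      linear_combination w₂ * (hr - h₁) - (r.1 - p.1) * h + w₁ * h₂
  · apply (mul_eq_zero_iff_left hu).1
    linear_combination u₂ * (hr - h₁) + (r.2 - p.2) * h + u₁ * h₂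

/-- Two algebraic lines with distinct zero sets through a point `p` of the torus meet exactly
in `p`. -/
theorem algLineSet_inter_eq_singleton {K : Type*} [Field K] {u₁ w₁ z₁ u₂ w₂ z₂ : K} {p : K × K}
    (hp₁ : p.1 ≠ 0) (hp₂ : p.2 ≠ 0)
    (h₀₁ : ¬(u₁ = 0 ∧ w₁ = 0 ∧ z₁ = 0)) (h₀₂ : ¬(u₂ = 0 ∧ w₂ = 0 ∧ z₂ = 0))
    (h₁ : u₁ * p.1 + w₁ * p.2 + z₁ = 0) (h₂ : u₂ * p.1 + w₂ * p.2 + z₂ = 0)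
    (hne : algLineSet u₁ w₁ z₁ ≠ algLineSet u₂ w₂ z₂) :
    algLineSet u₁ w₁ z₁ ∩ algLineSet u₂ w₂ z₂ = {p} := by
  have hdet : u₁ * w₂ - u₂ * w₁ ≠ 0 := fun h ↦
    hne ((algLineSet_subset_of_mul_eq_mul h₀₁ h₁ h₂ (sub_eq_zero.1 h)).antisymm
      (algLineSet_subset_of_mul_eq_mul h₀₂ h₂ h₁ (sub_eq_zero.1 h).symm))
  refine Set.Subset.antisymm ?_ (Set.singleton_subset_iff.2 ⟨⟨hp₁, hp₂, h₁⟩, hp₁, hp₂, h₂⟩)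
  rintro q ⟨⟨-, -, hq₁⟩, -, -, hq₂⟩
  refine Prod.ext (mul_left_cancel₀ hdet ?_) (mul_left_cancel₀ hdet ?_)
  · linear_combination w₂ * (hq₁ - h₁) - w₁ * (hq₂ - h₂)
  · linear_combination u₁ * (hq₂ - h₂) - u₂ * (hq₁ - h₁)

/-- failure of lifting for a non-admissible construction, with
`a = (0,0)`, `b = (−2,1)`, `c = (−1,3)`. -/
theorem nonadmissible_construction_no_lift
    {K : Type*} [Field K] [IsAlgClosed K] (V : RankOneVal K) :
    -- (i)
    Ltrop ((0 : ℝ), (0 : ℝ)) ((-2 : ℝ), (1 : ℝ)) = ((1 : ℝ), (0 : ℝ), (1 : ℝ)) ∧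
    Ltrop ((0 : ℝ), (0 : ℝ)) ((-1 : ℝ), (3 : ℝ)) = ((3 : ℝ), (0 : ℝ), (3 : ℝ)) ∧
    ((0 : ℝ), (0 : ℝ)) ∈ tropLineSet ((1 : ℝ), (0 : ℝ), (1 : ℝ)) ∧
    ((0 : ℝ), (0 : ℝ)) ∈ tropLineSet ((3 : ℝ), (0 : ℝ), (3 : ℝ)) ∧
    -- (ii)
    Mtrop ((1 : ℝ), (0 : ℝ), (1 : ℝ)) ((3 : ℝ), (0 : ℝ), (3 : ℝ)) = ((0 : ℝ), (1 : ℝ)) ∧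
    ((0 : ℝ), (1 : ℝ)) ≠ ((0 : ℝ), (0 : ℝ)) ∧
    -- (iii)
    (∀ pa pb pc : K × K,
      pa.1 ≠ 0 → pa.2 ≠ 0 → pb.1 ≠ 0 → pb.2 ≠ 0 → pc.1 ≠ 0 → pc.2 ≠ 0 →
      (V.T pa.1, V.T pa.2) = ((0 : ℝ), (0 : ℝ)) →
      (V.T pb.1, V.T pb.2) = ((-2 : ℝ), (1 : ℝ)) →
      (V.T pc.1, V.T pc.2) = ((-1 : ℝ), (3 : ℝ)) →
      ∀ u1 w1 z1 u2 w2 z2 : K,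
        ¬(u1 = 0 ∧ w1 = 0 ∧ z1 = 0) → ¬(u2 = 0 ∧ w2 = 0 ∧ z2 = 0) →
        u1 * pa.1 + w1 * pa.2 + z1 = 0 → u1 * pb.1 + w1 * pb.2 + z1 = 0 →
        u2 * pa.1 + w2 * pa.2 + z2 = 0 → u2 * pc.1 + w2 * pc.2 + z2 = 0 →
        algLineSet u1 w1 z1 ≠ algLineSet u2 w2 z2 →
        algLineSet u1 w1 z1 ∩ algLineSet u2 w2 z2 = {pa} ∧
        (V.T pa.1, V.T pa.2) ≠ ((0 : ℝ), (1 : ℝ))) := by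
  refine ⟨by norm_num [Ltrop], by norm_num [Ltrop], ⟨0, 2, by decide, by simp, ?_⟩,
    ⟨0, 2, by decide, by simp, ?_⟩, by norm_num [Mtrop], by simp, ?_⟩
  · intro l
    fin_cases l <;> simp
  · intro l
    fin_cases l <;> simp
  · intro pa pb pc ha₁ ha₂ _ _ _ _ hTa _ _ u1 w1 z1 u2 w2 z2 h₀₁ h₀₂ h₁ _ h₂ _ hne
    exact ⟨algLineSet_inter_eq_singleton ha₁ ha₂ h₀₁ h₀₂ h₁ h₂ hne, by simp [hTa]⟩
end

section
/- (Tropical Fano plane configuration theorem.) For all points p₁, p₃, p₅, p₇ ∈ ℝ² (repetitions allowed), define tropical line coefficient vectors a = L(p₁,p₃), b = L(p₁,p₅), c = L(p₁,p₇), d = L(p₃,p₅), e = L(p₃,p₇), f = L(p₅,p₇), and points p₂ = M(a,f), p₄ = M(c,d), p₆ = M(b,e). Then there exists (α,β,γ) ∈ ℝ³ such that p₂, p₄ and p₆ all lie on the tropical line with coefficient vector (α,β,γ). -/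
/-- The field of Hahn series in characteristic two, with lexicographic value group. The integer
component of an exponent breaks ties between monomials of equal real weight. -/
abbrev LexHahn : Type := HahnSeries (ℝ ×ₗ ℤ) (ZMod 2)

/-- The additive valuation of a Hahn series. -/
noncomputable abbrev lexVal : AddValuation LexHahn (WithTop (ℝ ×ₗ ℤ)) :=
  HahnSeries.addVal (ℝ ×ₗ ℤ) (ZMod 2)

/-- `f` tropicalizes (in the max convention) to `r`, with tie-breaking exponent in `S`. -/
def TropsTo (f : LexHahn) (r : ℝ) (S : Finset ℤ) : Prop :=
  ∃ n ∈ S, lexVal f = ((toLex (-r, n) : ℝ ×ₗ ℤ) : WithTop (ℝ ×ₗ ℤ))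

/-- The monomial tropicalizing to `r` with tie-breaking exponent `n`. -/
noncomputable def lexMonomial (r : ℝ) (n : ℤ) : LexHahn :=
  HahnSeries.single (toLex (-r, n)) 1

theorem tropsTo_lexMonomial (r : ℝ) (n : ℤ) : TropsTo (lexMonomial r n) r {n} :=
  ⟨n, by simp, by
    rw [lexMonomial, HahnSeries.addVal_apply, HahnSeries.orderTop_single one_ne_zero]⟩

theorem TropsTo.le_of_lexVal_le {f g : LexHahn} {r s : ℝ} {S T : Finset ℤ} (hf : TropsTo f r S)
    (hg : TropsTo g s T) (h : lexVal f ≤ lexVal g) : s ≤ r := by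
  obtain ⟨m, -, hf⟩ := hf
  obtain ⟨n, -, hg⟩ := hg
  rw [hf, hg, WithTop.coe_le_coe, Prod.Lex.toLex_le_toLex] at h
  rcases h with h | h <;> simp at h <;> linarith

open scoped Pointwise in
theorem TropsTo.mul {f g : LexHahn} {r s : ℝ} {S T : Finset ℤ} (hf : TropsTo f r S)
    (hg : TropsTo g s T) : TropsTo (f * g) (r + s) (S + T) := by
  obtain ⟨m, hm, hf⟩ := hf
  obtain ⟨n, hn, hg⟩ := hg
  refine ⟨m + n, Finset.add_mem_add hm hn, ?_⟩
  rw [lexVal.map_mul, hf, hg, ← WithTop.coe_add, ← toLex_add, Prod.mk_add_mk, neg_add]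

theorem TropsTo.sub {f g : LexHahn} {r s : ℝ} {S T : Finset ℤ} (hf : TropsTo f r S)
    (hg : TropsTo g s T) (h : Disjoint S T) : TropsTo (f - g) (max r s) (S ∪ T) := by
  have hfg := hf.le_of_lexVal_le hg
  have hgf := hg.le_of_lexVal_le hf
  obtain ⟨m, hm, hf⟩ := hf
  obtain ⟨n, hn, hg⟩ := hg
  have hmn : m ≠ n := fun e => Finset.disjoint_left.1 h hm (e ▸ hn)
  have hne : lexVal f ≠ lexVal (-g) := by
    rw [lexVal.map_neg, hf, hg]
    simp [hmn]
  have hv : lexVal (f - g) = min (lexVal f) (lexVal g) := by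
    rw [sub_eq_add_neg, lexVal.map_add_of_distinct_val hne, lexVal.map_neg]
  rw [TropsTo, hv]
  rcases le_total (lexVal f) (lexVal g) with hle | hle
  · refine ⟨m, Finset.mem_union_left _ hm, ?_⟩
    rw [min_eq_left hle, max_eq_left (hfg hle), hf]
  · refine ⟨n, Finset.mem_union_right _ hn, ?_⟩
    rw [min_eq_right hle, max_eq_right (hgf hle), hg]

theorem TropsTo.ne_zero {f : LexHahn} {r : ℝ} {S : Finset ℤ} (hf : TropsTo f r S) : f ≠ 0 := by
  rintro rfl
  obtain ⟨n, -, h⟩ := hf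
  simp at h

theorem exists_tropsTo {f : LexHahn} (hf : f ≠ 0) : ∃ r S, TropsTo f r S := by
  have h : lexVal f ≠ ⊤ := fun h => hf (lexVal.top_iff.1 h)
  obtain ⟨γ, hγ⟩ := WithTop.ne_top_iff_exists.1 h
  exact ⟨-(ofLex γ).1, {(ofLex γ).2}, (ofLex γ).2, by simp, by rw [← hγ]; simp⟩

/-- The maximum of the tropicalizations of the terms of a vanishing sum is attained twice. -/
theorem attainedTwice_of_sum_eq_zero {n : ℕ} {f : Fin n → LexHahn} {g : Fin n → ℝ}
    (hsum : ∑ i, f i = 0) (hne : ∃ i, f i ≠ 0)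
    (hg : ∀ i, f i ≠ 0 → ∃ S, TropsTo (f i) (g i) S)
    (hzero : ∀ i j, f i = 0 → f j ≠ 0 → g i ≤ g j) : attainedTwice g := by
  obtain ⟨k, hk⟩ := hne
  have : Nonempty (Fin n) := ⟨k⟩
  obtain ⟨i, hi⟩ := Finite.exists_min fun i => lexVal (f i)
  have hfi : f i ≠ 0 := fun h => hk <| lexVal.top_iff.1 <| top_le_iff.1 <| by
    simpa [h] using hi k
  have hvi : lexVal (f i) ≠ ⊤ := fun h => hfi (lexVal.top_iff.1 h)
  have hle : ∀ j, f j ≠ 0 → g j ≤ g i := by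
    intro j hfj
    obtain ⟨S, hS⟩ := hg i hfi
    obtain ⟨T, hT⟩ := hg j hfj
    exact hS.le_of_lexVal_le hT (hi j)
  obtain ⟨j, hji, hj⟩ : ∃ j, j ≠ i ∧ lexVal (f j) ≤ lexVal (f i) := by
    by_contra! hcon
    have hlt : lexVal (f i) < lexVal (∑ j ∈ Finset.univ.erase i, f j) :=
      lexVal.map_lt_sum hvi fun j hj => hcon j (Finset.ne_of_mem_erase hj)
    rw [← Finset.add_sum_erase _ _ (Finset.mem_univ i), add_eq_zero_iff_eq_neg] at hsum
    rw [hsum, lexVal.map_neg] at hlt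
    exact lt_irrefl _ hlt
  have hfj : f j ≠ 0 := fun h => hvi <| top_le_iff.1 <| by
    simpa [h] using hj
  refine ⟨i, j, hji.symm, le_antisymm ?_ (hle j hfj), fun l => ?_⟩
  · obtain ⟨S, hS⟩ := hg i hfi
    obtain ⟨T, hT⟩ := hg j hfj
    exact hT.le_of_lexVal_le hS hj
  · by_cases hl : f l = 0
    · exact hzero l i hl hfi
    · exact hle l hl

/-- If a singular matrix lifts the real matrix `Q`, then `Q` has a tropical kernel vector. -/
theorem exists_attainedTwice_of_det_eq_zero {n : ℕ} {P : Matrix (Fin n) (Fin n) LexHahn}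
    {Q : Fin n → Fin n → ℝ} (hdet : P.det = 0) (hP : ∀ k i, ∃ S, TropsTo (P k i) (Q k i) S) :
    ∃ l : Fin n → ℝ, ∀ k, attainedTwice fun i => l i + Q k i := by
  obtain ⟨A, hA, hPA⟩ := Matrix.exists_mulVec_eq_zero_iff.2 hdet
  have hP0 : ∀ k i, P k i ≠ 0 := fun k i => (hP k i).choose_spec.ne_zero
  have hval : ∀ i, ∃ r, A i ≠ 0 → ∃ S, TropsTo (A i) r S := fun i => by
    by_cases h : A i = 0
    · exact ⟨0, fun h' => (h' h).elim⟩
    · exact (exists_tropsTo h).imp fun _ hr _ => hr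
  choose a ha using hval
  obtain ⟨c, hc⟩ := (Set.finite_range fun t : Fin n × Fin n × Fin n =>
    a t.2.2 + Q t.1 t.2.2 - Q t.1 t.2.1).bddBelow
  classical
  refine ⟨fun i => if A i = 0 then c else a i, fun k =>
    attainedTwice_of_sum_eq_zero (f := fun i => A i * P k i) ?_ ?_ ?_ ?_⟩
  · simpa [Matrix.mulVec, dotProduct, mul_comm] using congrFun hPA k
  · obtain ⟨i, hi⟩ := Function.ne_iff.1 hA
    exact ⟨i, mul_ne_zero hi (hP0 k i)⟩
  · intro i hi
    have hAi : A i ≠ 0 := left_ne_zero_of_mul hi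
    obtain ⟨S, hS⟩ := ha i hAi
    obtain ⟨T, hT⟩ := hP k i
    simp only [if_neg hAi]
    exact ⟨_, hS.mul hT⟩
  · intro i j hi hj
    have hAi : A i = 0 := (mul_eq_zero.1 hi).resolve_right (hP0 k i)
    have hAj : A j ≠ 0 := left_ne_zero_of_mul hj
    have := hc ⟨(k, i, j), rfl⟩
    simp only [if_pos hAi, if_neg hAj]
    simp only at this
    linarith

theorem mem_tropLineSet_of_attainedTwice {l : Fin 3 → ℝ} {m₁ m₂ m₃ : ℝ}
    (h : attainedTwice fun i => l i + ![m₁, m₂, m₃] i) :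
    (m₁ - m₃, m₂ - m₃) ∈ tropLineSet (l 0, l 1, l 2) := by
  obtain ⟨i, j, hij, he, hle⟩ := h
  have key : ∀ i, ![l 0 + (m₁ - m₃), l 1 + (m₂ - m₃), l 2] i = l i + ![m₁, m₂, m₃] i - m₃ := by
    intro i
    fin_cases i <;> simp <;> ring
  refine ⟨i, j, hij, ?_, fun k => ?_⟩
  · rw [key, key]
    exact congrArg (· - m₃) he
  · rw [key, key]
    exact sub_le_sub_right (hle k) _

/-- Coefficients of the line through the affine points `(x, y)` and `(x', y')`, up to the sign
of each coordinate. -/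
def lineThrough {R : Type*} [CommRing R] (x y x' y' : R) : Fin 3 → R :=
  ![y - y', x - x', x * y' - y * x']

/-- Homogeneous coordinates of the intersection of two lines, up to the sign of each
coordinate. -/
def lineInter {R : Type*} [CommRing R] (a b : Fin 3 → R) : Fin 3 → R :=
  ![a 1 * b 2 - a 2 * b 1, a 0 * b 2 - a 2 * b 0, a 0 * b 1 - a 1 * b 0]

/-- The diagonal points of a complete quadrangle are collinear in characteristic two. -/
theorem det_diagonal_points_eq_zero {R : Type*} [CommRing R] (h2 : (2 : R) = 0)
    (x₁ y₁ x₃ y₃ x₅ y₅ x₇ y₇ : R) :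
    (Matrix.of ![lineInter (lineThrough x₁ y₁ x₃ y₃) (lineThrough x₅ y₅ x₇ y₇),
      lineInter (lineThrough x₁ y₁ x₇ y₇) (lineThrough x₃ y₃ x₅ y₅),
      lineInter (lineThrough x₁ y₁ x₅ y₅) (lineThrough x₃ y₃ x₇ y₇)]).det = 0 := by
  simp only [lineInter, lineThrough, Matrix.det_fin_three, Matrix.of_apply, Matrix.cons_val]
  linear_combination (-((x₁ * y₃ - y₁ * x₃) + (x₃ * y₅ - y₃ * x₅) + (x₅ * y₁ - y₅ * x₁)) *
    ((x₁ * y₃ - y₁ * x₃) + (x₃ * y₇ - y₃ * x₇) + (x₇ * y₁ - y₇ * x₁)) *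
    ((x₁ * y₅ - y₁ * x₅) + (x₅ * y₇ - y₅ * x₇) + (x₇ * y₁ - y₇ * x₁)) *
    ((x₃ * y₅ - y₃ * x₅) + (x₅ * y₇ - y₅ * x₇) + (x₇ * y₃ - y₇ * x₃))) * h2

theorem lexHahn_two_eq_zero : (2 : LexHahn) = 0 := by
  have h : (2 : ZMod 2) = 0 := by decide
  rw [← map_ofNat (HahnSeries.C : ZMod 2 →+* LexHahn) 2, h, map_zero]

/-- Real homogeneous coordinates of the stable intersection point. -/
noncomputable def interCoords (a b : ℝ × ℝ × ℝ) : Fin 3 → ℝ :=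
  ![max (a.2.1 + b.2.2) (a.2.2 + b.2.1), max (a.1 + b.2.2) (a.2.2 + b.1),
    max (a.1 + b.2.1) (a.2.1 + b.1)]

open scoped Pointwise in
/-- Tropicalization commutes with joining and intersecting when the tie-breaking exponents
separate the monomials involved. -/
theorem tropsTo_lineInter (p q r s : ℝ × ℝ) {a b a' b' c d c' d' : ℤ}
    (h₁ : Disjoint {b} ({b'} : Finset ℤ)) (h₂ : Disjoint {a} ({a'} : Finset ℤ))
    (h₃ : Disjoint ({a} + {b'}) ({b} + {a'} : Finset ℤ))
    (h₄ : Disjoint {d} ({d'} : Finset ℤ)) (h₅ : Disjoint {c} ({c'} : Finset ℤ))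
    (h₆ : Disjoint ({c} + {d'}) ({d} + {c'} : Finset ℤ))
    (h₇ : Disjoint (({a} ∪ {a'}) + (({c} + {d'}) ∪ ({d} + {c'})))
      ((({a} + {b'}) ∪ ({b} + {a'})) + ({c} ∪ {c'}) : Finset ℤ))
    (h₈ : Disjoint (({b} ∪ {b'}) + (({c} + {d'}) ∪ ({d} + {c'})))
      ((({a} + {b'}) ∪ ({b} + {a'})) + ({d} ∪ {d'}) : Finset ℤ))
    (h₉ : Disjoint (({b} ∪ {b'}) + ({c} ∪ {c'})) (({a} ∪ {a'}) + ({d} ∪ {d'}) : Finset ℤ))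
    (i : Fin 3) :
    ∃ S, TropsTo (lineInter
      (lineThrough (lexMonomial p.1 a) (lexMonomial p.2 b) (lexMonomial q.1 a')
        (lexMonomial q.2 b'))
      (lineThrough (lexMonomial r.1 c) (lexMonomial r.2 d) (lexMonomial s.1 c')
        (lexMonomial s.2 d')) i) (interCoords (Ltrop p q) (Ltrop r s) i) S := by
  have m := tropsTo_lexMonomial
  have l₁ := (m p.2 b).sub (m q.2 b') h₁
  have l₂ := (m p.1 a).sub (m q.1 a') h₂
  have l₃ := ((m p.1 a).mul (m q.2 b')).sub ((m p.2 b).mul (m q.1 a')) h₃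
  have l₄ := (m r.2 d).sub (m s.2 d') h₄
  have l₅ := (m r.1 c).sub (m s.1 c') h₅
  have l₆ := ((m r.1 c).mul (m s.2 d')).sub ((m r.2 d).mul (m s.1 c')) h₆
  fin_cases i
  · exact ⟨_, (l₂.mul l₆).sub (l₃.mul l₅) h₇⟩
  · exact ⟨_, (l₁.mul l₆).sub (l₃.mul l₄) h₈⟩
  · exact ⟨_, (l₁.mul l₅).sub (l₂.mul l₄) h₉⟩

/-- tropical Fano plane configuration theorem.  With
`a = L(p₁,p₃)`, `b = L(p₁,p₅)`, `c = L(p₁,p₇)`, `d = L(p₃,p₅)`, `e = L(p₃,p₇)`,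
`f = L(p₅,p₇)`, `p₂ = M(a,f)`, `p₄ = M(c,d)`, `p₆ = M(b,e)`, the points `p₂, p₄, p₆`
lie on a common tropical line. -/
theorem tropical_fano (p1 p3 p5 p7 : ℝ × ℝ) :
    ∃ l : ℝ × ℝ × ℝ,
      Mtrop (Ltrop p1 p3) (Ltrop p5 p7) ∈ tropLineSet l ∧
      Mtrop (Ltrop p1 p7) (Ltrop p3 p5) ∈ tropLineSet l ∧
      Mtrop (Ltrop p1 p5) (Ltrop p3 p7) ∈ tropLineSet l := by
  obtain ⟨l, hl⟩ := exists_attainedTwice_of_det_eq_zero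
    (Q := ![interCoords (Ltrop p1 p3) (Ltrop p5 p7), interCoords (Ltrop p1 p7) (Ltrop p3 p5),
      interCoords (Ltrop p1 p5) (Ltrop p3 p7)])
    (det_diagonal_points_eq_zero lexHahn_two_eq_zero
      (lexMonomial p1.1 1) (lexMonomial p1.2 2) (lexMonomial p3.1 4) (lexMonomial p3.2 8)
      (lexMonomial p5.1 16) (lexMonomial p5.2 32) (lexMonomial p7.1 64) (lexMonomial p7.2 128))
    (by
      intro k i
      fin_cases k
      · exact tropsTo_lineInter p1 p3 p5 p7 (by decide) (by decide) (by decide) (by decide)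
          (by decide) (by decide) (by decide) (by decide) (by decide) i
      · exact tropsTo_lineInter p1 p7 p3 p5 (by decide) (by decide) (by decide) (by decide)
          (by decide) (by decide) (by decide) (by decide) (by decide) i
      · exact tropsTo_lineInter p1 p5 p3 p7 (by decide) (by decide) (by decide) (by decide)
          (by decide) (by decide) (by decide) (by decide) (by decide) i)
  exact ⟨(l 0, l 1, l 2), mem_tropLineSet_of_attainedTwice (hl 0),
    mem_tropLineSet_of_attainedTwice (hl 1), mem_tropLineSet_of_attainedTwice (hl 2)⟩
end

section
/- (Constructive tropical Pappus theorem.) For all points p₁, p₂, p₃, p₄, p₅ ∈ ℝ², define tropical line coefficient vectors a = L(p₁,p₄), b = L(p₂,p₄), c = L(p₃,p₄), a′ = L(p₁,p₅), b′ = L(p₂,p₅), c′ = L(p₃,p₅); points p₆ = M(b,c′), p₇ = M(a′,c), p₈ = M(a,b′); and lines a″ = L(p₁,p₆), b″ = L(p₂,p₇), c″ = L(p₃,p₈). Then there exists a point p ∈ ℝ² lying simultaneously on the three tropical lines with coefficient vectors a″, b″ and c″. -/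
open MvPolynomial Matrix

variable {σ R : Type*} [CommRing R]

/-- The largest `w`-weight of a monomial of `f` is `a`; in particular `f ≠ 0`. -/
def HasWeight (w : σ → ℝ) (f : MvPolynomial σ R) (a : ℝ) : Prop :=
  (∀ m ∈ f.support, Finsupp.weight w m ≤ a) ∧ ∃ m ∈ f.support, Finsupp.weight w m = a

theorem HasWeight.exists_of_ne_zero (w : σ → ℝ) {f : MvPolynomial σ R} (hf : f ≠ 0) :
    ∃ a, HasWeight w f a := by
  obtain ⟨m, hm, hmax⟩ :=
    f.support.exists_max_image (Finsupp.weight w) (support_nonempty.mpr hf)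
  exact ⟨_, hmax, m, hm, rfl⟩

theorem hasWeight_X [Nontrivial R] (w : σ → ℝ) (i : σ) :
    HasWeight w (X i : MvPolynomial σ R) (w i) := by
  simp [HasWeight, support_X, Finsupp.weight_apply]

theorem hasWeight_one [Nontrivial R] (w : σ → ℝ) : HasWeight w (1 : MvPolynomial σ R) 0 := by
  classical
  have h : (1 : MvPolynomial σ R).support = {0} := support_one
  simp [HasWeight, h]

theorem HasWeight.mul [IsDomain R] {w : σ → ℝ} {f g : MvPolynomial σ R} {a b : ℝ}
    (hf : HasWeight w f a) (hg : HasWeight w g b) : HasWeight w (f * g) (a + b) := by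
  classical
  constructor
  · intro m hm
    obtain ⟨i, hi, j, hj, rfl⟩ := Finset.mem_add.mp (support_mul f g hm)
    rw [map_add]
    exact add_le_add (hf.1 i hi) (hg.1 j hj)
  · have top_ne_zero {h : MvPolynomial σ R} {c : ℝ} (hh : HasWeight w h c) :
        weightedHomogeneousComponent w c h ≠ 0 := by
      obtain ⟨m, hm, hc⟩ := hh.2
      refine ne_zero_iff.mpr ⟨m, ?_⟩
      rw [coeff_weightedHomogeneousComponent, if_pos hc]
      exact mem_support_iff.mp hm
    obtain ⟨m, hm⟩ := ne_zero_iff.mp (mul_ne_zero (top_ne_zero hf) (top_ne_zero hg))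
    have hwm : Finsupp.weight w m = a + b :=
      ((weightedHomogeneousComponent_isWeightedHomogeneous a f).mul
        (weightedHomogeneousComponent_isWeightedHomogeneous b g)) hm
    refine ⟨m, ?_, hwm⟩
    rw [mem_support_iff]
    convert hm using 1
    rw [coeff_mul, coeff_mul]
    refine Finset.sum_congr rfl fun ⟨i, j⟩ hij => ?_
    rw [Finset.HasAntidiagonal.mem_antidiagonal] at hij
    simp only [coeff_weightedHomogeneousComponent]
    by_cases hi : coeff i f = 0
    · simp [hi]
    by_cases hj : coeff j g = 0
    · simp [hj]
    have h1 := hf.1 i (mem_support_iff.mpr hi)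
    have h2 := hg.1 j (mem_support_iff.mpr hj)
    rw [← hij, map_add] at hwm
    rw [if_pos (by linarith), if_pos (by linarith)]

theorem HasWeight.sub {w : σ → ℝ} {f g : MvPolynomial σ R} {a b : ℝ}
    (hf : HasWeight w f a) (hg : HasWeight w g b) (hfg : Disjoint f.support g.support) :
    HasWeight w (f - g) (max a b) := by
  classical
  have mem_left {m} (hm : m ∈ f.support) : m ∈ (f - g).support := by
    have := notMem_support_iff.mp (Finset.disjoint_left.mp hfg hm)
    simpa [this] using hm
  have mem_right {m} (hm : m ∈ g.support) : m ∈ (f - g).support := by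
    have := notMem_support_iff.mp (Finset.disjoint_right.mp hfg hm)
    simpa [this] using hm
  constructor
  · intro m hm
    rcases Finset.mem_union.mp (support_sub _ f g hm) with h | h
    · exact le_max_of_le_left (hf.1 m h)
    · exact le_max_of_le_right (hg.1 m h)
  · obtain ⟨m, hm, ha⟩ := hf.2
    obtain ⟨n, hn, hb⟩ := hg.2
    rcases max_choice a b with h | h <;> rw [h]
    · exact ⟨m, mem_left hm, ha⟩
    · exact ⟨n, mem_right hn, hb⟩

theorem HasWeight.le_or_le_of_add_eq_zero {w : σ → ℝ} {f g h : MvPolynomial σ R} {a b c : ℝ}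
    (hf : HasWeight w f a) (hg : HasWeight w g b) (hh : HasWeight w h c) (hsum : f + g + h = 0) :
    a ≤ b ∨ a ≤ c := by
  obtain ⟨m, hm, rfl⟩ := hf.2
  by_cases hmg : m ∈ g.support
  · exact Or.inl (hg.1 m hmg)
  · refine Or.inr (hh.1 m ?_)
    rw [mem_support_iff] at hm ⊢
    have := congrArg (coeff m) hsum
    rw [coeff_add, coeff_add, notMem_support_iff.mp hmg, coeff_zero] at this
    intro h0
    exact hm (by simpa [h0] using this)

theorem attainedTwice_of_le_or_le {a b c : ℝ} (ha : a ≤ b ∨ a ≤ c) (hb : b ≤ a ∨ b ≤ c)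
    (hc : c ≤ a ∨ c ≤ b) : attainedTwice ![a, b, c] := by
  have key : (a = b ∧ c ≤ a) ∨ (a = c ∧ b ≤ a) ∨ (b = c ∧ a ≤ b) := by grind
  rcases key with ⟨h, h'⟩ | ⟨h, h'⟩ | ⟨h, h'⟩
  · exact ⟨0, 1, by decide, by simpa using h, by simp [Fin.forall_fin_succ, h.ge, h']⟩
  · exact ⟨0, 2, by decide, by simpa using h, by simp [Fin.forall_fin_succ, h.ge, h']⟩
  · exact ⟨1, 2, by decide, by simpa using h, by simp [Fin.forall_fin_succ, h.ge, h']⟩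

theorem disjoint_support_mul {S T : Set σ} (hST : Disjoint S T) {f f' g g' : MvPolynomial σ R}
    (hf : f ∈ supported R S) (hf' : f' ∈ supported R S)
    (hg : g ∈ supported R T) (hg' : g' ∈ supported R T) (h : Disjoint f.support f'.support) :
    Disjoint (f * g).support (f' * g').support := by
  classical
  have filter_add {i j : σ →₀ ℕ} {p q : MvPolynomial σ R} (hp : p ∈ supported R S)
      (hq : q ∈ supported R T) (hi : i ∈ p.support) (hj : j ∈ q.support) :
      (i + j).filter (· ∈ S) = i := by
    ext s
    by_cases hs : s ∈ S
    · rw [Finsupp.filter_apply_pos _ _ hs, Finsupp.add_apply]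
      by_contra hne
      exact Set.disjoint_left.mp hST hs (mem_supported.mp hq
        (mem_vars_iff_mem_support s |>.mpr ⟨j, hj, Finsupp.mem_support_iff.mpr (by omega)⟩))
    · rw [Finsupp.filter_apply_neg _ _ hs]
      by_contra hne
      exact hs (mem_supported.mp hp
        (mem_vars_iff_mem_support s |>.mpr ⟨i, hi, Finsupp.mem_support_iff.mpr (Ne.symm hne)⟩))
  rw [Finset.disjoint_left]
  intro m hm hm'
  obtain ⟨i, hi, j, hj, rfl⟩ := Finset.mem_add.mp (support_mul f g hm)
  obtain ⟨i', hi', j', hj', hij⟩ := Finset.mem_add.mp (support_mul f' g' hm')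
  have hii : i' = i := by
    rw [← filter_add hf' hg' hi' hj', hij, filter_add hf hg hi hj]
  exact Finset.disjoint_left.mp h hi (hii ▸ hi')

/-- The tropical cross product, which underlies both Cramer rules. -/
noncomputable def tropCross (a b : Fin 3 → ℝ) : Fin 3 → ℝ :=
  ![max (a 1 + b 2) (a 2 + b 1), max (a 2 + b 0) (a 0 + b 2), max (a 0 + b 1) (a 1 + b 0)]

/-- `P` is a vector of polynomials in the variables `S`, no two of which share a monomial, and
its vector of `w`-weights is `a`. -/
structure IsGenericLift (w : σ → ℝ) (S : Set σ) (P : Fin 3 → MvPolynomial σ R)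
    (a : Fin 3 → ℝ) : Prop where
  hasWeight : ∀ i, HasWeight w (P i) (a i)
  mem_supported : ∀ i, P i ∈ supported R S
  disjoint : ∀ i j, i ≠ j → Disjoint (P i).support (P j).support

theorem IsGenericLift.cross [IsDomain R] {w : σ → ℝ} {S T : Set σ}
    {P Q : Fin 3 → MvPolynomial σ R} {a b : Fin 3 → ℝ} (hP : IsGenericLift w S P a)
    (hQ : IsGenericLift w T Q b) (hST : Disjoint S T) :
    IsGenericLift w (S ∪ T) (P ⨯₃ Q) (tropCross a b) := by
  classical
  have disj (i j k l : Fin 3) (h : i ≠ k ∨ j ≠ l) :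
      Disjoint (P i * Q j).support (P k * Q l).support := by
    rcases h with h | h
    · exact disjoint_support_mul hST (hP.mem_supported _) (hP.mem_supported _)
        (hQ.mem_supported _) (hQ.mem_supported _) (hP.disjoint _ _ h)
    · rw [mul_comm (P i), mul_comm (P k)]
      exact disjoint_support_mul hST.symm (hQ.mem_supported _) (hQ.mem_supported _)
        (hP.mem_supported _) (hP.mem_supported _) (hQ.disjoint _ _ h)
  have disj_sub {f g f' g' : MvPolynomial σ R} (h₁ : Disjoint f.support f'.support)
      (h₂ : Disjoint f.support g'.support) (h₃ : Disjoint g.support f'.support)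
      (h₄ : Disjoint g.support g'.support) : Disjoint (f - g).support (f' - g').support :=
    Disjoint.mono (support_sub σ f g) (support_sub σ f' g') (by
      simp only [Finset.disjoint_union_left, Finset.disjoint_union_right]
      exact ⟨⟨h₁, h₃⟩, ⟨h₂, h₄⟩⟩)
  have supp (i j : Fin 3) : P i * Q j ∈ supported R (S ∪ T) :=
    mul_mem (supported_mono Set.subset_union_left (hP.mem_supported i))
      (supported_mono Set.subset_union_right (hQ.mem_supported j))
  have wt (i j : Fin 3) := (hP.hasWeight i).mul (hQ.hasWeight j)
  rw [cross_apply]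
  refine ⟨fun i => ?_, fun i => ?_, fun i j hij => ?_⟩
  · fin_cases i <;> exact (wt _ _).sub (wt _ _) (disj _ _ _ _ (by decide))
  · fin_cases i <;> exact sub_mem (supp _ _) (supp _ _)
  · fin_cases i <;> fin_cases j <;> first
      | exact absurd rfl hij
      | exact disj_sub (disj _ _ _ _ (by decide)) (disj _ _ _ _ (by decide))
          (disj _ _ _ _ (by decide)) (disj _ _ _ _ (by decide))

theorem attainedTwice_of_dotProduct_eq_zero [IsDomain R] {w : σ → ℝ}
    {P Q : Fin 3 → MvPolynomial σ R} {a b : Fin 3 → ℝ} (hP : ∀ i, HasWeight w (P i) (a i))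
    (hQ : ∀ i, HasWeight w (Q i) (b i)) (h : P ⬝ᵥ Q = 0) :
    attainedTwice ![a 0 + b 0, a 1 + b 1, a 2 + b 2] := by
  rw [vec3_dotProduct] at h
  have wt (i : Fin 3) := (hP i).mul (hQ i)
  refine attainedTwice_of_le_or_le ?_ ?_ ?_
  · exact (wt 0).le_or_le_of_add_eq_zero (wt 1) (wt 2) h
  · exact (wt 1).le_or_le_of_add_eq_zero (wt 0) (wt 2) (by rw [← h]; ring)
  · exact (wt 2).le_or_le_of_add_eq_zero (wt 0) (wt 1) (by rw [← h]; ring)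

/-- The point with index `i` of the generic planar configuration indexed by `ι`. -/
noncomputable def homogeneousPoint {ι : Type*} (i : ι) : Fin 3 → MvPolynomial (ι × Fin 2) ℤ :=
  ![X (i, 0), X (i, 1), 1]

theorem isGenericLift_homogeneousPoint {ι : Type*} (w : ι × Fin 2 → ℝ) (i : ι) :
    IsGenericLift w (Prod.fst ⁻¹' {i}) (homogeneousPoint i) ![w (i, 0), w (i, 1), 0] := by
  classical
  have h1 : (1 : MvPolynomial (ι × Fin 2) ℤ).support = {0} := support_one
  refine ⟨fun j => ?_, fun j => ?_, fun j k hjk => ?_⟩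
  · fin_cases j
    exacts [hasWeight_X w _, hasWeight_X w _, hasWeight_one w]
  · fin_cases j
    exacts [X_mem_supported.mpr rfl, X_mem_supported.mpr rfl, one_mem _]
  · have hX (s : ι × Fin 2) : (0 : ι × Fin 2 →₀ ℕ) ≠ Finsupp.single s 1 := by
      simp [eq_comm (a := (0 : ι × Fin 2 →₀ ℕ))]
    fin_cases j <;> fin_cases k <;>
      simp [homogeneousPoint, support_X, h1, Finsupp.single_eq_single_iff, hX] at hjk ⊢

/-- **Pappus' theorem** in homogeneous coordinates. -/
theorem pappus_cross_dotProduct (p₁ p₂ p₃ p₄ p₅ : Fin 3 → R) :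
    (p₃ ⨯₃ ((p₁ ⨯₃ p₄) ⨯₃ (p₂ ⨯₃ p₅))) ⬝ᵥ
      ((p₁ ⨯₃ ((p₂ ⨯₃ p₄) ⨯₃ (p₃ ⨯₃ p₅))) ⨯₃ (p₂ ⨯₃ ((p₁ ⨯₃ p₅) ⨯₃ (p₃ ⨯₃ p₄)))) = 0 := by
  have cross_cross_cross (u v w x : Fin 3 → R) :
      (u ⨯₃ v) ⨯₃ (w ⨯₃ x) = (u ⬝ᵥ w ⨯₃ x) • v - (v ⬝ᵥ w ⨯₃ x) • u := by
    rw [cross_cross_eq_smul_sub_smul, dotProduct_comm]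
  have swap₁ (u v w : Fin 3 → R) : v ⬝ᵥ u ⨯₃ w = -(u ⬝ᵥ v ⨯₃ w) := by
    rw [triple_product_permutation, ← cross_anticomm, dotProduct_neg]
  have swap₂ (u v w : Fin 3 → R) : u ⬝ᵥ w ⨯₃ v = -(u ⬝ᵥ v ⨯₃ w) := by
    rw [← cross_anticomm, dotProduct_neg]
  have plucker : (p₁ ⬝ᵥ p₂ ⨯₃ p₅) * (p₂ ⬝ᵥ p₃ ⨯₃ p₄) + (p₂ ⬝ᵥ p₄ ⨯₃ p₅) * (p₁ ⬝ᵥ p₂ ⨯₃ p₃) -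
      (p₂ ⬝ᵥ p₃ ⨯₃ p₅) * (p₁ ⬝ᵥ p₂ ⨯₃ p₄) = 0 := by
    simp only [cross_apply, vec3_dotProduct, Matrix.cons_val]
    ring
  rw [dotProduct_comm]
  simp only [cross_cross_cross, map_sub, map_smul, LinearMap.sub_apply, LinearMap.smul_apply,
    dotProduct_sub, dotProduct_smul, sub_dotProduct, smul_dotProduct, dot_self_cross,
    dot_cross_self, smul_eq_mul]
  simp only [swap₁ p₁ p₂, swap₁ p₁ p₃, swap₁ p₂ p₄, swap₁ p₃ p₄, swap₁ p₃ p₅, swap₂ _ p₁,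
    swap₂ _ p₄ p₅]
  linear_combination (p₁ ⬝ᵥ p₃ ⨯₃ p₄) * (p₃ ⬝ᵥ p₄ ⨯₃ p₅) * (p₁ ⬝ᵥ p₂ ⨯₃ p₅) * plucker

theorem map_cross {S : Type*} [CommRing S] (φ : R →+* S) (u v : Fin 3 → R) :
    φ ∘ (u ⨯₃ v) = (φ ∘ u) ⨯₃ (φ ∘ v) := by
  ext i
  fin_cases i <;> simp [cross_apply]

theorem IsGenericLift.cross_cross_cross {ι : Type*} (w : ι × Fin 2 → ℝ) {i j k l m : ι}
    (h : [i, j, k, l, m].Nodup) :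
    ∃ S, IsGenericLift w S
      (homogeneousPoint i ⨯₃ ((homogeneousPoint j ⨯₃ homogeneousPoint k) ⨯₃
        (homogeneousPoint l ⨯₃ homogeneousPoint m)))
      (tropCross ![w (i, 0), w (i, 1), 0]
        (tropCross (tropCross ![w (j, 0), w (j, 1), 0] ![w (k, 0), w (k, 1), 0])
          (tropCross ![w (l, 0), w (l, 1), 0] ![w (m, 0), w (m, 1), 0]))) := by
  have lift := isGenericLift_homogeneousPoint w
  simp only [List.nodup_cons, List.mem_cons, List.not_mem_nil, or_false, not_or] at h
  have disj {a b : ι} (hab : a ≠ b) :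
      Disjoint (Prod.fst ⁻¹' {a} : Set (ι × Fin 2)) (Prod.fst ⁻¹' {b}) :=
    Disjoint.preimage _ (Set.disjoint_singleton.mpr hab)
  refine ⟨_, (lift i).cross (((lift j).cross (lift k) (disj ?_)).cross
    ((lift l).cross (lift m) (disj ?_)) ?_) ?_⟩
  · tauto
  · tauto
  · simp only [Set.disjoint_union_left, Set.disjoint_union_right]
    exact ⟨⟨disj (by tauto), disj (by tauto)⟩, disj (by tauto), disj (by tauto)⟩
  · simp only [Set.disjoint_union_right]
    exact ⟨⟨disj (by tauto), disj (by tauto)⟩, disj (by tauto), disj (by tauto)⟩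

theorem attainedTwice.sub_const {n : ℕ} {f : Fin n → ℝ} (h : attainedTwice f) (c : ℝ) :
    attainedTwice fun i => f i - c := by
  obtain ⟨i, j, hij, heq, hmax⟩ := h
  exact ⟨i, j, hij, congrArg (· - c) heq, fun l => sub_le_sub_right (hmax l) c⟩

theorem mem_tropLineSet_of_attainedTwice_s14 {t q : Fin 3 → ℝ} (c : ℝ)
    (h : attainedTwice ![t 0 + q 0, t 1 + q 1, t 2 + q 2]) :
    (q 0 - q 2, q 1 - q 2) ∈ tropLineSet (t 0 - c, t 1 - c, t 2 - c) := by
  have h' := h.sub_const (c + q 2)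
  rw [tropLineSet, Set.mem_ofPred_eq]
  convert h' using 1
  ext i
  fin_cases i <;> simp <;> ring

theorem Ltrop_eq_tropCross (p q : ℝ × ℝ) :
    Ltrop p q = (tropCross ![p.1, p.2, 0] ![q.1, q.2, 0] 0,
      tropCross ![p.1, p.2, 0] ![q.1, q.2, 0] 1, tropCross ![p.1, p.2, 0] ![q.1, q.2, 0] 2) := by
  simp [Ltrop, tropCross, max_comm]

theorem Mtrop_eq_tropCross (a b : Fin 3 → ℝ) :
    Mtrop (a 0, a 1, a 2) (b 0, b 1, b 2) =
      (tropCross a b 0 - tropCross a b 2, tropCross a b 1 - tropCross a b 2) := by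
  simp [Mtrop, tropCross, max_comm]

theorem Ltrop_sub_eq_tropCross (p : ℝ × ℝ) (t : Fin 3 → ℝ) :
    Ltrop p (t 0 - t 2, t 1 - t 2) = (tropCross ![p.1, p.2, 0] t 0 - t 2,
      tropCross ![p.1, p.2, 0] t 1 - t 2, tropCross ![p.1, p.2, 0] t 2 - t 2) := by
  simp [Ltrop, tropCross, max_comm, ← max_sub_sub_right, add_sub_assoc]

theorem pappusPoint_ne_zero (i : Fin 3) :
    ((homogeneousPoint (0 : Fin 5) ⨯₃ ((homogeneousPoint 1 ⨯₃ homogeneousPoint 3) ⨯₃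
        (homogeneousPoint 2 ⨯₃ homogeneousPoint 4))) ⨯₃
      (homogeneousPoint 1 ⨯₃ ((homogeneousPoint 0 ⨯₃ homogeneousPoint 4) ⨯₃
        (homogeneousPoint 2 ⨯₃ homogeneousPoint 3)))) i ≠ 0 := by
  let x : Fin 5 × Fin 2 → ℤ := fun s =>
    (![![0, 0], ![0, 1], ![1, 0], ![1, 2], ![2, 1]] : Fin 5 → Fin 2 → ℤ) s.1 s.2
  have eval_point (j : Fin 5) : eval x ∘ homogeneousPoint j = ![x (j, 0), x (j, 1), 1] := by
    ext k
    fin_cases k <;> simp [homogeneousPoint]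
  intro h
  have h' := congrArg (eval x) h
  rw [map_zero, ← Function.comp_apply (f := eval x)] at h'
  simp only [map_cross, eval_point] at h'
  revert h'
  fin_cases i <;> simp [x, cross_apply]

/-- constructive tropical Pappus theorem.  With
`a = L(p₁,p₄)`, `b = L(p₂,p₄)`, `c = L(p₃,p₄)`, `a′ = L(p₁,p₅)`, `b′ = L(p₂,p₅)`,
`c′ = L(p₃,p₅)`, `p₆ = M(b,c′)`, `p₇ = M(a′,c)`, `p₈ = M(a,b′)`,
`a″ = L(p₁,p₆)`, `b″ = L(p₂,p₇)`, `c″ = L(p₃,p₈)`, the three tropical lines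
`a″`, `b″`, `c″` have a common point. -/
theorem tropical_pappus (p1 p2 p3 p4 p5 : ℝ × ℝ) :
    ∃ p : ℝ × ℝ,
      p ∈ tropLineSet (Ltrop p1 (Mtrop (Ltrop p2 p4) (Ltrop p3 p5))) ∧
      p ∈ tropLineSet (Ltrop p2 (Mtrop (Ltrop p1 p5) (Ltrop p3 p4))) ∧
      p ∈ tropLineSet (Ltrop p3 (Mtrop (Ltrop p1 p4) (Ltrop p2 p5))) := by
  let w : Fin 5 × Fin 2 → ℝ := fun s =>
    ![(![p1, p2, p3, p4, p5] s.1).1, (![p1, p2, p3, p4, p5] s.1).2] s.2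
  choose q hq using fun i => HasWeight.exists_of_ne_zero w (pappusPoint_ne_zero i)
  obtain ⟨_, ha⟩ := IsGenericLift.cross_cross_cross w (i := 0) (j := 1) (k := 3) (l := 2) (m := 4)
    (by decide)
  obtain ⟨_, hb⟩ := IsGenericLift.cross_cross_cross w (i := 1) (j := 0) (k := 4) (l := 2) (m := 3)
    (by decide)
  obtain ⟨_, hc⟩ := IsGenericLift.cross_cross_cross w (i := 2) (j := 0) (k := 3) (l := 1) (m := 4)
    (by decide)
  refine ⟨(q 0 - q 2, q 1 - q 2), ?_, ?_, ?_⟩ <;>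
    rw [Ltrop_eq_tropCross _ p4, Ltrop_eq_tropCross _ p5, Mtrop_eq_tropCross,
      Ltrop_sub_eq_tropCross] <;>
    apply mem_tropLineSet_of_attainedTwice_s14
  · exact attainedTwice_of_dotProduct_eq_zero ha.hasWeight hq (dot_self_cross _ _)
  · exact attainedTwice_of_dotProduct_eq_zero hb.hasWeight hq (dot_cross_self _ _)
  · exact attainedTwice_of_dotProduct_eq_zero hc.hasWeight hq (pappus_cross_dotProduct _ _ _ _ _)
end
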